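/- For k ∈ (0, k_max), a density p attains the infimum defining V(k) if and only if p = p_{θ₁,θ₂} μ-a.e. for some (θ₁,θ₂) ∈ Θ with θ₂ < 0 and H(p_{θ₁,θ₂}) = k; moreover, for such p the condition H(p_{θ₁,θ₂}) = k is equivalent to ∫ X p_{θ₁,θ₂} dμ = V(k). -/

import Mathlib

open MeasureTheory Filter Set Topology
open scoped ENNReal

noncomputable section

variable {Ω : Type*} [MeasurableSpace Ω]

/-- The positive part of an extended real number, as a member of `ℝ≥0∞`. -/
def ePos (x : EReal) : ℝ≥0∞ := if x = ⊤ then ⊤ else ENNReal.ofReal x.toReal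

/-- The (signed) integral of an extended-real-valued function: the integral of its
positive part minus the integral of its negative part. -/
def eInt (μ : Measure Ω) (f : Ω → EReal) : EReal :=
  ((∫⁻ r, ePos (f r) ∂μ : ℝ≥0∞) : EReal) - ((∫⁻ r, ePos (-(f r)) ∂μ : ℝ≥0∞) : EReal)

/-- `p` is a probability density with respect to `μ`. -/
def IsDensity (μ : Measure Ω) (p : Ω → ℝ) : Prop :=
  Measurable p ∧ (∀ r, 0 ≤ p r) ∧ ∫⁻ r, ENNReal.ofReal (p r) ∂μ = 1

/-- `∫ p dμ` for a nonnegative function `p`. -/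
def pInt (μ : Measure Ω) (p : Ω → ℝ) : ℝ≥0∞ := ∫⁻ r, ENNReal.ofReal (p r) ∂μ

/-- The convex integral functional `H(p) = ∫ β(r, p(r)) μ(dr)`. -/
def Hfun (μ : Measure Ω) (β : Ω → ℝ → EReal) (p : Ω → ℝ) : EReal :=
  eInt μ (fun r => β r (p r))

/-- The expected payoff `∫ X p dμ`, as an extended real number. -/
def xInt (μ : Measure Ω) (X p : Ω → ℝ) : EReal :=
  eInt μ (fun r => ((X r * p r : ℝ) : EReal))

/-- The value function `F(b) = inf { H(p) : p density, ∫ X p dμ = b }`. -/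
def Ffun (μ : Measure Ω) (β : Ω → ℝ → EReal) (X : Ω → ℝ) (b : ℝ) : EReal :=
  ⨅ p : {p : Ω → ℝ // IsDensity μ p ∧ xInt μ X p = (b : EReal)}, Hfun μ β p.1

/-- The essential infimum `m` of `X`, as an extended real number. -/
def essInfX (μ : Measure Ω) (X : Ω → ℝ) : EReal := essInf (fun r => (X r : EReal)) μ

/-- The essential supremum `M` of `X`, as an extended real number. -/
def essSupX (μ : Measure Ω) (X : Ω → ℝ) : EReal := essSup (fun r => (X r : EReal)) μ

/-- `k_max = lim_{b ↓ m} F(b)`; since `F` is nonincreasing on `(m, b₀)`, this limit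
equals the supremum of `F` over `(m, b₀)`. -/
def kmax (μ : Measure Ω) (β : Ω → ℝ → EReal) (X : Ω → ℝ) (b₀ : ℝ) : EReal :=
  ⨆ b : {b : ℝ // essInfX μ X < (b : EReal) ∧ b < b₀}, Ffun μ β X b

/-- `V(k) = inf { ∫ X p dμ : p density, H(p) ≤ k }`. -/
def Vfun (μ : Measure Ω) (β : Ω → ℝ → EReal) (X : Ω → ℝ) (k : ℝ) : EReal :=
  ⨅ p : {p : Ω → ℝ // IsDensity μ p ∧ Hfun μ β p ≤ (k : EReal)}, xInt μ X p.1

/-- `W(λ) = inf { ∫ X p dμ + λ H(p) : p density }`. -/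
def Wfun (μ : Measure Ω) (β : Ω → ℝ → EReal) (X : Ω → ℝ) (lam : ℝ) : EReal :=
  ⨅ p : {p : Ω → ℝ // IsDensity μ p}, (xInt μ X p.1 + (lam : EReal) * Hfun μ β p.1)

/-- The convex conjugate `β*(r, τ) = sup_s (sτ − β(r,s))` of `β` in its second variable. -/
def conjβ (β : Ω → ℝ → EReal) (r : Ω) (τ : ℝ) : EReal :=
  ⨆ s : ℝ, (((s * τ : ℝ) : EReal) - β r s)

/-- `K(θ₁, θ₂) = ∫ β*(r, θ₁ + θ₂ X(r)) μ(dr)`. -/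
def Kfun (μ : Measure Ω) (β : Ω → ℝ → EReal) (X : Ω → ℝ) (θ₁ θ₂ : ℝ) : EReal :=
  eInt μ (fun r => conjβ β r (θ₁ + θ₂ * X r))

/-- `dom K = {(θ₁, θ₂) : K(θ₁,θ₂) < +∞}`. -/
def domK (μ : Measure Ω) (β : Ω → ℝ → EReal) (X : Ω → ℝ) : Set (ℝ × ℝ) :=
  {θ : ℝ × ℝ | Kfun μ β X θ.1 θ.2 < ⊤}

/-- `β'(r, +∞) = lim_{s ↑ ∞} β'(r,s)`; by monotonicity of the derivative of a convex
function this equals the supremum of `β'(r, ·)` over `(0, ∞)`. -/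
def derivTop (β' : Ω → ℝ → ℝ) (r : Ω) : EReal := ⨆ s : {s : ℝ // 0 < s}, (β' r s.1 : EReal)

/-- `β'(r, 0) = lim_{s ↓ 0} β'(r,s)`, the infimum of `β'(r, ·)` over `(0, ∞)`. -/
def derivZero (β' : Ω → ℝ → ℝ) (r : Ω) : EReal := ⨅ s : {s : ℝ // 0 < s}, (β' r s.1 : EReal)

/-- The parameter set `Θ`. -/
def ThetaSet (μ : Measure Ω) (β : Ω → ℝ → EReal) (β' : Ω → ℝ → ℝ) (X : Ω → ℝ) :
    Set (ℝ × ℝ) :=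
  {θ ∈ domK μ β X | ∀ᵐ r ∂μ, ((θ.1 + θ.2 * X r : ℝ) : EReal) < derivTop β' r}

/-- The generalised exponential family member `p_{θ₁,θ₂}(r) = (β*)'(r, θ₁ + θ₂ X(r))`,
where `ψ` denotes the derivative `(β*)'` of the conjugate in its second variable. -/
def pFam (ψ : Ω → ℝ → ℝ) (X : Ω → ℝ) (θ₁ θ₂ : ℝ) : Ω → ℝ :=
  fun r => ψ r (θ₁ + θ₂ * X r)

/-- `G(θ₂) = inf_{θ₁} [K(θ₁,θ₂) − θ₁]`. -/
def Gfun (μ : Measure Ω) (β : Ω → ℝ → EReal) (X : Ω → ℝ) (θ₂ : ℝ) : EReal :=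
  ⨅ θ₁ : ℝ, (Kfun μ β X θ₁ θ₂ - (θ₁ : EReal))

/-- `Θ₂ = dom G`, the projection of `dom K` to the `θ₂`-axis. -/
def Theta2 (μ : Measure Ω) (β : Ω → ℝ → EReal) (X : Ω → ℝ) : Set ℝ :=
  {θ₂ : ℝ | Gfun μ β X θ₂ < ⊤}

/-- The Bregman integrand `Δ_β(r, s, t)`; for `t = 0` it is defined as the limit `t ↓ 0`
(with `β'(r,0) = lim_{t↓0} β'(r,t)`), and if `β(r,0) = +∞` then `Δ_β(r,0,0) = 0` and
`Δ_β(r,s,0) = +∞` for `s > 0`. -/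
def bregmanInt (β : Ω → ℝ → EReal) (β' : Ω → ℝ → ℝ) (r : Ω) (s t : ℝ) : EReal :=
  if 0 < t then β r s - β r t - ((β' r t : EReal) * ((s - t : ℝ) : EReal))
  else if β r 0 = ⊤ then (if s = 0 then 0 else ⊤)
  else β r s - β r 0 - derivZero β' r * ((s : ℝ) : EReal)

/-- The (generalised) Bregman distance `B(p, q)`. -/
def Bdist (μ : Measure Ω) (β : Ω → ℝ → EReal) (β' : Ω → ℝ → ℝ) (p q : Ω → ℝ) : EReal :=
  eInt μ (fun r => bregmanInt β β' r (p r) (q r))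

/-- The standing assumptions of the framework: `μ` is σ-finite; `β` is a normal convex
integrand (measurable in `r`; equal to `+∞` for `s < 0`; finite, strictly convex and
differentiable with derivative `β'` on `(0,∞)`; right-continuous at `0`); `p₀` is a
density with finite expected payoff `b₀` satisfying `m < b₀ < M`; `H(p₀) = 0 ≤ H(p)`
for every density `p`; and `k_max > 0`. -/
structure Standing (μ : Measure Ω) (β : Ω → ℝ → EReal) (β' : Ω → ℝ → ℝ)
    (X : Ω → ℝ) (p₀ : Ω → ℝ) (b₀ : ℝ) : Prop where
  sigma : SigmaFinite μ
  betaMeas : ∀ s : ℝ, Measurable (fun r => β r s)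
  Xmeas : Measurable X
  betaNeg : ∀ r : Ω, ∀ s : ℝ, s < 0 → β r s = ⊤
  betaNeBot : ∀ r s, β r s ≠ ⊥
  betaFin : ∀ r : Ω, ∀ s : ℝ, 0 < s → β r s ≠ ⊤
  betaZero : ∀ r, Tendsto (fun s => β r s) (𝓝[>] (0:ℝ)) (𝓝 (β r 0))
  betaConv : ∀ r, StrictConvexOn ℝ (Ioi (0:ℝ)) (fun s => (β r s).toReal)
  betaDeriv : ∀ r : Ω, ∀ s ∈ Ioi (0:ℝ), HasDerivAt (fun t => (β r t).toReal) (β' r s) s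
  dens₀ : IsDensity μ p₀
  payoff₀ : xInt μ X p₀ = (b₀ : EReal)
  mlt : essInfX μ X < (b₀ : EReal)
  ltM : (b₀ : EReal) < essSupX μ X
  H₀ : Hfun μ β p₀ = 0
  Hnonneg : ∀ p, IsDensity μ p → 0 ≤ Hfun μ β p
  kmaxPos : 0 < kmax μ β X b₀

/-- The hypothesis that `ψ = (β*)'`: at every point `τ < β'(r,+∞)`, where the conjugate
`β*(r,·)` is finite and differentiable, `ψ r τ` is its derivative. -/
def IsConjDeriv (β : Ω → ℝ → EReal) (β' : Ω → ℝ → ℝ) (ψ : Ω → ℝ → ℝ) : Prop :=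
  ∀ r : Ω, ∀ τ : ℝ, ((τ : ℝ) : EReal) < derivTop β' r →
    HasDerivAt (fun t => (conjβ β r t).toReal) (ψ r τ) τ

/-- `(θ₁, θ₂)` with `θ₂ < 0` attains the double maximum
`max_{θ₂<0} max_{θ₁} (k + K(θ₁,θ₂) − θ₁)/θ₂` (whose value is `V(k)`); such a pair is a
parameter pair of the worst case localiser `q̂_k = p_{θ₁,θ₂}`. -/
def IsWCLParam (μ : Measure Ω) (β : Ω → ℝ → EReal) (X : Ω → ℝ) (k : ℝ) (θ₁ θ₂ : ℝ) : Prop :=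
  θ₂ < 0 ∧ ∀ θ₁' θ₂' : ℝ, θ₂' < 0 →
    ((k : EReal) + Kfun μ β X θ₁' θ₂' - (θ₁' : EReal)) / ((θ₂' : ℝ) : EReal) ≤
      ((k : EReal) + Kfun μ β X θ₁ θ₂ - (θ₁ : EReal)) / ((θ₂ : ℝ) : EReal)

/-- `p` is an (ε-γ)-almost worst case density for threshold `k`. -/
def AWCD (μ : Measure Ω) (β : Ω → ℝ → EReal) (X : Ω → ℝ) (k ε γ : ℝ) (p : Ω → ℝ) : Prop :=
  IsDensity μ p ∧ Hfun μ β p ≤ ((k + γ : ℝ) : EReal) ∧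
    xInt μ X p ≤ Vfun μ β X k + (ε : EReal)

/-- Convergence locally in measure. -/
def TendstoLocallyInMeasure (μ : Measure Ω) (p : ℕ → Ω → ℝ) (q : Ω → ℝ) : Prop :=
  ∀ C : Set Ω, MeasurableSet C → μ C < ⊤ → ∀ ε : ℝ, 0 < ε →
    Tendsto (fun n => μ {r ∈ C | ε < |p n r - q r|}) atTop (𝓝 0)

end

/-- A closed convex function on the half-line, strictly convex with derivative `f'` on `(0, ∞)`:
the properties of a single fibre `β(r, ·)`. -/
structure ConvexFibre (f : ℝ → EReal) (f' : ℝ → ℝ) : Prop where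
  eq_top_of_neg : ∀ s < 0, f s = ⊤
  ne_bot : ∀ s, f s ≠ ⊥
  ne_top : ∀ s, 0 < s → f s ≠ ⊤
  tendsto_zero : Tendsto f (𝓝[>] 0) (𝓝 (f 0))
  hasDerivAt : ∀ s ∈ Ioi (0 : ℝ), HasDerivAt (fun t => (f t).toReal) (f' s) s
  strictConvexOn : StrictConvexOn ℝ (Ioi 0) fun s => (f s).toReal

/-- `τ` is a subgradient of `f` at `s₀`; by right-continuity it suffices to test on `(0, ∞)`. -/
def IsSubgradient (f : ℝ → EReal) (s₀ τ : ℝ) : Prop :=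
  0 ≤ s₀ ∧ f s₀ ≠ ⊤ ∧ ∀ s, 0 < s → (f s₀).toReal + τ * (s - s₀) ≤ (f s).toReal

namespace ConvexFibre

variable {f : ℝ → EReal} {f' : ℝ → ℝ}

lemma coe_toReal (hf : ConvexFibre f f') {s : ℝ} (hs : f s ≠ ⊤) : ((f s).toReal : EReal) = f s :=
  EReal.coe_toReal hs (hf.ne_bot s)

lemma tendsto_right (hf : ConvexFibre f f') {s : ℝ} (hs : 0 ≤ s) :
    Tendsto f (𝓝[>] s) (𝓝 (f s)) := by
  rcases hs.eq_or_lt with rfl | hs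
  · exact hf.tendsto_zero
  · have h1 : ContinuousAt (fun t => ((f t).toReal : EReal)) s :=
      continuous_coe_real_ereal.continuousAt.comp (hf.hasDerivAt s hs).continuousAt
    have h2 : Tendsto (fun t => ((f t).toReal : EReal)) (𝓝[>] s) (𝓝 (f s)) := by
      have := h1.tendsto
      rw [hf.coe_toReal (hf.ne_top s hs)] at this
      exact this.mono_left nhdsWithin_le_nhds
    refine h2.congr' ?_
    filter_upwards [self_mem_nhdsWithin] with t ht
    exact hf.coe_toReal (hf.ne_top t (hs.trans ht))

lemma tendsto_toReal_right (hf : ConvexFibre f f') {s : ℝ} (hs : 0 ≤ s) (h : f s ≠ ⊤) :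
    Tendsto (fun t => (f t).toReal) (𝓝[>] s) (𝓝 (f s).toReal) :=
  (EReal.tendsto_toReal h (hf.ne_bot s)).comp (hf.tendsto_right hs)

lemma ne_top_of_bound (hf : ConvexFibre f f') {s C : ℝ} (hs : 0 ≤ s)
    (h : ∀ᶠ t in 𝓝[>] s, (f t).toReal ≤ C) : f s ≠ ⊤ := by
  have : f s ≤ (C : EReal) := by
    refine le_of_tendsto (hf.tendsto_right hs) ?_
    filter_upwards [h, self_mem_nhdsWithin] with t ht hts
    rw [← hf.coe_toReal (hf.ne_top t (hs.trans_lt hts))]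
    exact_mod_cast ht
  exact ne_top_of_le_ne_top (EReal.coe_ne_top C) this

/-- The convexity inequality on the closed half-line. -/
lemma le_combo (hf : ConvexFibre f f') {s s' x x' a b : ℝ} (hs : 0 ≤ s) (hs' : 0 ≤ s')
    (hx : f s ≤ (x : EReal)) (hx' : f s' ≤ (x' : EReal)) (ha : 0 ≤ a) (hb : 0 ≤ b)
    (hab : a + b = 1) : f (a * s + b * s') ≤ ((a * x + b * x' : ℝ) : EReal) := by
  have ht : f s ≠ ⊤ := ne_top_of_le_ne_top (EReal.coe_ne_top x) hx
  have ht' : f s' ≠ ⊤ := ne_top_of_le_ne_top (EReal.coe_ne_top x') hx'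
  have hsh : ∀ u : ℝ, Tendsto (fun e : ℝ => u + e) (𝓝[>] 0) (𝓝[>] u) := by
    intro u
    refine tendsto_nhdsWithin_iff.2 ⟨?_, ?_⟩
    · have : Tendsto (fun e : ℝ => u + e) (𝓝 0) (𝓝 (u + 0)) :=
        (continuous_const.add continuous_id).tendsto 0
      rw [add_zero] at this
      exact this.mono_left nhdsWithin_le_nhds
    · filter_upwards [self_mem_nhdsWithin] with e he
      simpa using he
  have h0 : 0 ≤ a * s + b * s' := by positivity
  have hL := (hf.tendsto_right h0).comp (hsh (a * s + b * s'))
  have hR := ((hf.tendsto_toReal_right hs ht).comp (hsh s)).const_mul a |>.add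
    (((hf.tendsto_toReal_right hs' ht').comp (hsh s')).const_mul b)
  have hR' := (continuous_coe_real_ereal.tendsto _).comp hR
  have key : f (a * s + b * s') ≤ ((a * (f s).toReal + b * (f s').toReal : ℝ) : EReal) := by
    refine le_of_tendsto_of_tendsto hL hR' ?_
    filter_upwards [self_mem_nhdsWithin] with e he
    have he : 0 < e := he
    have hc := hf.strictConvexOn.convexOn.2 (x := s + e) (by simp; positivity)
      (y := s' + e) (by simp; positivity) ha hb hab
    have hpt : a * s + b * s' + e = a * (s + e) + b * (s' + e) := by
      linear_combination (-e) * hab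
    simp only [smul_eq_mul, ← hpt] at hc
    simp only [Function.comp]
    rw [← hf.coe_toReal (hf.ne_top (a * s + b * s' + e) (by positivity))]
    exact_mod_cast hc
  refine key.trans ?_
  rw [← hf.coe_toReal ht] at hx
  rw [← hf.coe_toReal ht'] at hx'
  have hx := EReal.coe_le_coe_iff.1 hx
  have hx' := EReal.coe_le_coe_iff.1 hx'
  exact_mod_cast (by gcongr)

lemma tangent_le (hf : ConvexFibre f f') {s t : ℝ} (hs : 0 < s) (ht : 0 < t) :
    (f s).toReal + f' s * (t - s) ≤ (f t).toReal := by
  rcases lt_trichotomy s t with h | rfl | h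
  · have := hf.strictConvexOn.convexOn.le_slope_of_hasDerivAt hs ht h (hf.hasDerivAt s hs)
    rw [slope_def_field, le_div_iff₀ (by linarith)] at this
    linarith
  · simp
  · have := hf.strictConvexOn.convexOn.slope_le_of_hasDerivAt ht hs h (hf.hasDerivAt s hs)
    rw [slope_def_field, div_le_iff₀ (by linarith)] at this
    linarith

lemma strict_tangent_lt (hf : ConvexFibre f f') {s t : ℝ} (hs : 0 < s) (hst : t < s) (ht : 0 < t) :
    (f s).toReal + f' s * (t - s) < (f t).toReal := by
  have := hf.strictConvexOn.slope_lt_of_hasDerivAt ht hs hst (hf.hasDerivAt s hs)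
  rw [slope_def_field, div_lt_iff₀ (by linarith)] at this
  linarith

end ConvexFibre

namespace IsSubgradient

variable {f : ℝ → EReal} {f' : ℝ → ℝ} {s₀ τ : ℝ}

lemma le_of_le (h : IsSubgradient f s₀ τ) (hf : ConvexFibre f f') {s x : ℝ} (hs : 0 ≤ s)
    (hx : f s ≤ (x : EReal)) : (f s₀).toReal + τ * (s - s₀) ≤ x := by
  have ht : f s ≠ ⊤ := ne_top_of_le_ne_top (EReal.coe_ne_top x) hx
  have hl : Tendsto (fun t => (f s₀).toReal + τ * (t - s₀)) (𝓝[>] s)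
      (𝓝 ((f s₀).toReal + τ * (s - s₀))) := by
    have : Continuous fun t : ℝ => (f s₀).toReal + τ * (t - s₀) := by fun_prop
    exact (this.tendsto s).mono_left nhdsWithin_le_nhds
  have := le_of_tendsto_of_tendsto hl (hf.tendsto_toReal_right hs ht) (by
    filter_upwards [self_mem_nhdsWithin] with t hts
    exact h.2.2 t (hs.trans_lt hts))
  refine this.trans ?_
  rw [← hf.coe_toReal ht] at hx
  exact_mod_cast hx

lemma conj_eq (h : IsSubgradient f s₀ τ) (hf : ConvexFibre f f') :
    ⨆ s : ℝ, (((s * τ : ℝ) : EReal) - f s) = ((s₀ * τ - (f s₀).toReal : ℝ) : EReal) := by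
  apply le_antisymm
  · refine iSup_le fun s => ?_
    by_cases hs : f s = ⊤
    · simp [hs]
    · have hs0 : 0 ≤ s := by
        by_contra hneg
        exact hs (hf.eq_top_of_neg s (not_le.1 hneg))
      have := h.le_of_le hf hs0 (hf.coe_toReal hs).ge
      rw [← hf.coe_toReal hs]
      exact_mod_cast (by linarith)
  · refine le_trans ?_ (le_iSup _ s₀)
    rw [← hf.coe_toReal h.2.1]
    exact_mod_cast le_of_eq (by simp)

lemma lt_derivTop (h : IsSubgradient f s₀ τ) (hf : ConvexFibre f f') :
    (τ : EReal) < ⨆ s : {s : ℝ // 0 < s}, (f' s.1 : EReal) := by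
  by_contra hcon
  have hle : ∀ s, 0 < s → f' s ≤ τ := fun s hs => by
    have := (le_iSup (fun s : {s : ℝ // 0 < s} => (f' s.1 : EReal)) ⟨s, hs⟩).trans (not_lt.1 hcon)
    exact_mod_cast this
  have hanti : ∀ s t, 0 < t → t < s → (f s).toReal - τ * s < (f t).toReal - τ * t := by
    intro s t ht hts
    have h1 := hf.strict_tangent_lt (ht.trans hts) hts ht
    have h2 := mul_le_mul_of_nonneg_right (hle s (ht.trans hts)) (sub_nonneg.2 hts.le)
    nlinarith
  have h1 := h.2.2 (s₀ + 2) (by linarith [h.1])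
  have h2 := hanti (s₀ + 2) (s₀ + 1) (by linarith [h.1]) (by linarith)
  have h3 : (f (s₀ + 1)).toReal - τ * (s₀ + 1) ≤ (f s₀).toReal - τ * s₀ := by
    have hl : Tendsto (fun t => (f t).toReal - τ * t) (𝓝[>] s₀)
        (𝓝 ((f s₀).toReal - τ * s₀)) :=
      (hf.tendsto_toReal_right h.1 h.2.1).sub
        (((continuous_const.mul continuous_id).tendsto s₀).mono_left nhdsWithin_le_nhds)
    refine ge_of_tendsto hl ?_
    filter_upwards [Ioo_mem_nhdsGT (show s₀ < s₀ + 1 by linarith)] with t ht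
    exact (hanti _ _ (h.1.trans_lt ht.1) ht.2).le
  linarith

end IsSubgradient

namespace ConvexFibre

variable {f : ℝ → EReal} {f' : ℝ → ℝ} {τ : ℝ}

lemma exists_isSubgradient (hf : ConvexFibre f f')
    (hτ : (τ : EReal) < ⨆ s : {s : ℝ // 0 < s}, (f' s.1 : EReal)) :
    ∃ s₀, IsSubgradient f s₀ τ := by
  obtain ⟨⟨s₁, hs₁⟩, h1⟩ := lt_iSup_iff.1 hτ
  have h1 : τ < f' s₁ := by exact_mod_cast h1
  by_cases hex : ∃ s₂, 0 < s₂ ∧ f' s₂ ≤ τ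
  · obtain ⟨s₂, hs₂, h2⟩ := hex
    have hoc := (ordConnected_Ioi (a := (0 : ℝ))).image_hasDerivWithinAt
      (f := fun t => (f t).toReal) (f' := f') fun x hx => (hf.hasDerivAt x hx).hasDerivWithinAt
    obtain ⟨s₀, hs₀, rfl⟩ := hoc.out ⟨s₂, hs₂, rfl⟩ ⟨s₁, hs₁, rfl⟩ ⟨h2, h1.le⟩
    exact ⟨s₀, le_of_lt hs₀, hf.ne_top s₀ hs₀, fun s hs => hf.tangent_le hs₀ hs⟩
  · push Not at hex
    have hmono : ∀ s t, 0 < t → t < s → (f t).toReal + τ * (s - t) ≤ (f s).toReal := by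
      intro s t ht hts
      have h2 := hf.tangent_le ht (ht.trans hts)
      have h3 := mul_le_mul_of_nonneg_right (hex t ht).le (sub_nonneg.2 hts.le)
      linarith
    have h0 : f 0 ≠ ⊤ := by
      refine hf.ne_top_of_bound (C := (f 1).toReal + |τ|) le_rfl ?_
      filter_upwards [Ioo_mem_nhdsGT (show (0 : ℝ) < 1 by norm_num)] with t ht
      have h2 := hmono 1 t ht.1 ht.2
      have h3 : -|τ| * 1 ≤ τ * (1 - t) := by
        have := abs_mul τ (1 - t)
        have h4 : |1 - t| ≤ 1 := by rw [abs_le]; constructor <;> linarith [ht.1, ht.2]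
        nlinarith [neg_abs_le (τ * (1 - t)), abs_nonneg τ]
      linarith
    refine ⟨0, le_rfl, h0, fun s hs => ?_⟩
    have hl : Tendsto (fun t => (f t).toReal + τ * (s - t)) (𝓝[>] 0)
        (𝓝 ((f 0).toReal + τ * (s - 0))) := by
      refine (hf.tendsto_toReal_right le_rfl h0).add ?_
      have : Continuous fun t : ℝ => τ * (s - t) := by fun_prop
      exact (this.tendsto 0).mono_left nhdsWithin_le_nhds
    refine le_of_tendsto hl ?_
    filter_upwards [Ioo_mem_nhdsGT hs] with t ht
    exact hmono s t ht.1 ht.2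

/-- Where the conjugate is differentiable, its derivative is the point of tangency. -/
lemma eq_of_hasDerivAt_conj (hf : ConvexFibre f f') {s₀ d : ℝ} (h : IsSubgradient f s₀ τ)
    (hd : HasDerivAt (fun t : ℝ => (⨆ s : ℝ, (((s * t : ℝ) : EReal) - f s)).toReal) d τ) :
    d = s₀ := by
  have hτ := h.lt_derivTop hf
  have hnear : ∀ᶠ t : ℝ in 𝓝 τ, (t : EReal) < ⨆ s : {s : ℝ // 0 < s}, (f' s.1 : EReal) :=
    continuous_coe_real_ereal.continuousAt.eventually_lt continuousAt_const hτ
  have hmin : IsLocalMin (fun t : ℝ =>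
      (⨆ s : ℝ, (((s * t : ℝ) : EReal) - f s)).toReal - s₀ * t) τ := by
    filter_upwards [hnear] with t ht
    obtain ⟨s₁, h₁⟩ := hf.exists_isSubgradient ht
    rw [h.conj_eq hf, h₁.conj_eq hf, EReal.toReal_coe, EReal.toReal_coe]
    have := h₁.le_of_le hf h.1 (hf.coe_toReal h.2.1).ge
    linarith
  have hd' := hmin.hasDerivAt_eq_zero (hd.sub ((hasDerivAt_id τ).const_mul s₀))
  linarith

end ConvexFibre

/-- A convex set in finite dimension that misses the origin lies in a half-space. -/
lemma exists_ne_zero_forall_nonneg {E : Type*} [NormedAddCommGroup E] [NormedSpace ℝ E]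
    [FiniteDimensional ℝ E] {S : Set E} (hS : Convex ℝ S) (hne : S.Nonempty) (h0 : (0 : E) ∉ S) :
    ∃ f : E →ₗ[ℝ] ℝ, f ≠ 0 ∧ ∀ x ∈ S, 0 ≤ f x := by
  by_cases hsp : affineSpan ℝ S = ⊤
  · have hint := hS.interior_nonempty_iff_affineSpan_eq_top.2 hsp
    obtain ⟨f, hf0, hf⟩ := geometric_hahn_banach_of_nonempty_interior_point hS
      (x := 0) (fun h => h0 (interior_subset h)) hint
    refine ⟨-f.toLinearMap, ?_, fun x hx => ?_⟩
    · intro h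
      apply hf0
      ext x
      simpa using congrArg (fun g : E →ₗ[ℝ] ℝ => g x) h
    · have := hf x hx
      simp at this
      simpa using this
  · rw [AffineSubspace.affineSpan_eq_top_iff_vectorSpan_eq_top_of_nonempty ℝ E E hne] at hsp
    obtain ⟨f, hf0, hf⟩ := (vectorSpan ℝ S).exists_le_ker_of_lt_top (lt_top_iff_ne_top.2 hsp)
    obtain ⟨y, hy⟩ := hne
    have hconst : ∀ x ∈ S, f x = f y := fun x hx => by
      have := hf (vsub_mem_vectorSpan ℝ hx hy)
      simpa [sub_eq_zero] using this
    rcases le_total 0 (f y) with h | h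
    · exact ⟨f, hf0, fun x hx => (hconst x hx).symm ▸ h⟩
    · refine ⟨-f, neg_ne_zero.2 hf0, fun x hx => ?_⟩
      rw [LinearMap.neg_apply, hconst x hx]
      linarith

section Integral

variable {Ω : Type*} [MeasurableSpace Ω] {μ : Measure Ω}

lemma ePos_eq_toENNReal (x : EReal) : ePos x = x.toENNReal := rfl

lemma eInt_mono {f g : Ω → EReal} (h : f ≤ᵐ[μ] g) : eInt μ f ≤ eInt μ g := by
  refine EReal.sub_le_sub ?_ ?_ <;> refine EReal.coe_ennreal_le_coe_ennreal_iff.2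
    (lintegral_mono_ae ?_) <;> filter_upwards [h] with r hr <;>
    simp only [ePos_eq_toENNReal] <;> apply EReal.toENNReal_le_toENNReal
  · exact hr
  · exact EReal.neg_le_neg_iff.2 hr

lemma eInt_congr {f g : Ω → EReal} (h : f =ᵐ[μ] g) : eInt μ f = eInt μ g :=
  le_antisymm (eInt_mono h.le) (eInt_mono h.symm.le)

lemma eInt_coe_def (g : Ω → ℝ) : eInt μ (fun r => (g r : EReal)) =
    ((∫⁻ r, ENNReal.ofReal (g r) ∂μ : ℝ≥0∞) : EReal)
      - ((∫⁻ r, ENNReal.ofReal (-g r) ∂μ : ℝ≥0∞) : EReal) := rfl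

lemma eInt_coe {g : Ω → ℝ} (hg : Integrable g μ) :
    eInt μ (fun r => (g r : EReal)) = ((∫ r, g r ∂μ : ℝ) : EReal) := by
  have h1 : ∫⁻ r, ENNReal.ofReal (g r) ∂μ ≠ ⊤ := hg.lintegral_lt_top.ne
  have h2 : ∫⁻ r, ENNReal.ofReal (-g r) ∂μ ≠ ⊤ := hg.neg.lintegral_lt_top.ne
  rw [eInt_coe_def, integral_eq_lintegral_pos_part_sub_lintegral_neg_part hg, EReal.coe_sub,
    EReal.coe_ennreal_toReal h1, EReal.coe_ennreal_toReal h2]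

lemma integrable_of_lintegral_ne_top {g : Ω → ℝ} (hm : AEStronglyMeasurable g μ)
    (h1 : ∫⁻ r, ENNReal.ofReal (g r) ∂μ ≠ ⊤) (h2 : ∫⁻ r, ENNReal.ofReal (-g r) ∂μ ≠ ⊤) :
    Integrable g μ := by
  refine ⟨hm, ?_⟩
  rw [hasFiniteIntegral_iff_norm]
  have : ∀ r, ENNReal.ofReal ‖g r‖ ≤ ENNReal.ofReal (g r) + ENNReal.ofReal (-g r) := by
    intro r
    rw [Real.norm_eq_abs]
    rcases le_total 0 (g r) with h | h
    · rw [abs_of_nonneg h]; exact le_self_add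
    · rw [abs_of_nonpos h]; exact le_add_self
  refine (lintegral_mono this).trans_lt ?_
  rw [lintegral_add_left' hm.aemeasurable.ennreal_ofReal]
  exact ENNReal.add_lt_top.2 ⟨h1.lt_top, h2.lt_top⟩

lemma eInt_parts_ne_top {f : Ω → EReal} (hb : eInt μ f ≠ ⊥) (ht : eInt μ f ≠ ⊤) :
    ∫⁻ r, ePos (f r) ∂μ ≠ ⊤ ∧ ∫⁻ r, ePos (-f r) ∂μ ≠ ⊤ := by
  unfold eInt at hb ht
  generalize ∫⁻ r, ePos (f r) ∂μ = a at *
  generalize ∫⁻ r, ePos (-f r) ∂μ = b at *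
  have hbt : b ≠ ⊤ := by
    rintro rfl
    simp at hb
  refine ⟨?_, hbt⟩
  rintro rfl
  apply ht
  rw [← EReal.coe_ennreal_toReal hbt]
  simp

/-- A measurable function with real integral is a.e. finite and integrable. -/
lemma eInt_real {f : Ω → EReal} (hm : AEMeasurable f μ) (hb : eInt μ f ≠ ⊥) (ht : eInt μ f ≠ ⊤) :
    (∀ᵐ r ∂μ, f r ≠ ⊤) ∧ (∀ᵐ r ∂μ, f r ≠ ⊥) ∧ Integrable (fun r => (f r).toReal) μ := by
  obtain ⟨h1, h2⟩ := eInt_parts_ne_top hb ht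
  have hft : ∀ᵐ r ∂μ, f r ≠ ⊤ := by
    filter_upwards [ae_lt_top' (f := fun r => ePos (f r))
      (measurable_ereal_toENNReal.comp_aemeasurable hm) h1] with r hr h
    simp [h, ePos] at hr
  have hfb : ∀ᵐ r ∂μ, f r ≠ ⊥ := by
    filter_upwards [ae_lt_top' (f := fun r => ePos (-f r))
      (measurable_ereal_toENNReal.comp_aemeasurable hm.neg) h2] with r hr h
    simp [h, ePos] at hr
  refine ⟨hft, hfb, integrable_of_lintegral_ne_top
    (measurable_ereal_toReal.comp_aemeasurable hm).aestronglyMeasurable ?_ ?_⟩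
  · refine ne_top_of_le_ne_top h1 (lintegral_mono_ae ?_)
    filter_upwards [hft] with r hr
    simp [ePos, hr]
  · refine ne_top_of_le_ne_top h2 (lintegral_mono_ae ?_)
    filter_upwards [hfb] with r hr
    simp [ePos, hr]

lemma integrable_of_le_of_eInt_lt_top {g l : Ω → ℝ} (hm : AEStronglyMeasurable g μ)
    (hl : Integrable l μ) (hlg : ∀ᵐ r ∂μ, l r ≤ g r)
    (ht : eInt μ (fun r => (g r : EReal)) ≠ ⊤) : Integrable g μ := by
  have hb : eInt μ (fun r => (g r : EReal)) ≠ ⊥ := by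
    have := eInt_mono (μ := μ) (f := fun r => (l r : EReal)) (g := fun r => (g r : EReal))
      (by filter_upwards [hlg] with r hr; exact_mod_cast hr)
    rw [eInt_coe hl] at this
    exact ne_bot_of_le_ne_bot (EReal.coe_ne_bot _) this
  have := (eInt_real (f := fun r => (g r : EReal)) hm.aemeasurable.coe_real_ereal hb ht).2.2
  simpa using this

/-- A Carathéodory-type measurability statement with one-sided continuity. -/
lemma measurable_comp_of_tendsto_right {f : Ω → ℝ → EReal} (hf : ∀ s, Measurable fun r => f r s)
    (hr : ∀ r s, 0 ≤ s → Tendsto (f r) (𝓝[>] s) (𝓝 (f r s))) {p : Ω → ℝ} (hp : Measurable p)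
    (h0 : ∀ r, 0 ≤ p r) : Measurable fun r => f r (p r) := by
  let q : ℕ → Ω → ℝ := fun n r => ((⌊(n + 1 : ℝ) * p r⌋₊ : ℝ) + 1) / (n + 1)
  have hq : ∀ n, Measurable fun r => f r (q n r) := by
    intro n
    have h1 : Measurable fun z : Ω × ℕ => f z.1 (((z.2 : ℝ) + 1) / (n + 1)) :=
      measurable_from_prod_countable_left fun m => hf (((m : ℝ) + 1) / (n + 1))
    exact h1.comp (measurable_id.prodMk (Nat.measurable_floor.comp (hp.const_mul _)))
  refine measurable_of_tendsto_metrizable hq (tendsto_pi_nhds.2 fun r => ?_)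
  refine (hr r (p r) (h0 r)).comp (tendsto_nhdsWithin_iff.2 ⟨?_, Eventually.of_forall fun n => ?_⟩)
  · have h1 : Tendsto (fun n : ℕ => p r + 1 / ((n : ℝ) + 1)) atTop (𝓝 (p r)) := by
      simpa using (tendsto_const_nhds (x := p r)).add tendsto_one_div_add_atTop_nhds_zero_nat
    refine tendsto_of_tendsto_of_tendsto_of_le_of_le tendsto_const_nhds h1 (fun n => ?_)
      (fun n => ?_)
    · have hn : (0 : ℝ) < n + 1 := by positivity
      simp only [q]
      rw [le_div_iff₀ hn]
      have := (Nat.lt_floor_add_one ((n + 1 : ℝ) * p r)).le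
      linarith
    · have hn : (0 : ℝ) < n + 1 := by positivity
      simp only [q]
      rw [div_le_iff₀ hn, add_mul (p r), div_mul_cancel₀ _ hn.ne']
      have := Nat.floor_le (mul_nonneg hn.le (h0 r))
      linarith
  · have hn : (0 : ℝ) < n + 1 := by positivity
    simp only [q, mem_Ioi]
    rw [lt_div_iff₀ hn]
    have := Nat.lt_floor_add_one ((n + 1 : ℝ) * p r)
    linarith

/-- A nonnull set contains a nonnull set of finite measure on which a given function is bounded. -/
lemma exists_subset_bounded [SigmaFinite μ] {A : Set Ω} (hA : MeasurableSet A) (hA0 : μ A ≠ 0)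
    {u : Ω → ℝ} (hu : Measurable u) :
    ∃ B ⊆ A, MeasurableSet B ∧ μ B ≠ 0 ∧ μ B ≠ ⊤ ∧ ∃ C : ℝ, ∀ r ∈ B, |u r| ≤ C := by
  have hcov : A = ⋃ n : ℕ, A ∩ {r | |u r| ≤ n} := by
    ext r
    simp only [mem_iUnion, mem_inter_iff, mem_ofPred_eq, exists_and_left, iff_self_and]
    exact fun _ => exists_nat_ge _
  obtain ⟨n, hn⟩ : ∃ n : ℕ, μ (A ∩ {r | |u r| ≤ n}) ≠ 0 := by
    by_contra! h
    exact hA0 (hcov ▸ measure_iUnion_null h)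
  obtain ⟨B, hB, hBs, hB0, hBt⟩ := Measure.exists_subset_measure_lt_top (r := 0)
    (hA.inter (measurableSet_le (continuous_abs.measurable.comp hu) measurable_const))
    (pos_iff_ne_zero.2 hn)
  exact ⟨B, hBs.trans inter_subset_left, hB, hB0.ne', hBt.ne, n, fun r hr => (hBs hr).2⟩

end Integral

section Density

variable {Ω : Type*} [MeasurableSpace Ω] {μ : Measure Ω} {β : Ω → ℝ → EReal} {β' : Ω → ℝ → ℝ}
  {X p₀ : Ω → ℝ} {b₀ : ℝ}

lemma Standing.fibre (hst : Standing μ β β' X p₀ b₀) (r : Ω) : ConvexFibre (β r) (β' r) :=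
  ⟨hst.betaNeg r, hst.betaNeBot r, hst.betaFin r, hst.betaZero r, hst.betaDeriv r, hst.betaConv r⟩

lemma Standing.measurable_comp (hst : Standing μ β β' X p₀ b₀) {q : Ω → ℝ} (hq : Measurable q)
    (h0 : ∀ r, 0 ≤ q r) : Measurable fun r => β r (q r) :=
  measurable_comp_of_tendsto_right hst.betaMeas (fun r _ hs => (hst.fibre r).tendsto_right hs) hq h0

lemma IsDensity.integrable {q : Ω → ℝ} (hq : IsDensity μ q) : Integrable q μ := by
  refine integrable_of_lintegral_ne_top hq.1.aestronglyMeasurable (by simp [hq.2.2]) ?_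
  have : ∀ r, ENNReal.ofReal (-q r) = 0 := fun r => by simpa using hq.2.1 r
  simp [this]

lemma IsDensity.integral_eq_one {q : Ω → ℝ} (hq : IsDensity μ q) : ∫ r, q r ∂μ = 1 := by
  rw [integral_eq_lintegral_of_nonneg_ae (Eventually.of_forall hq.2.1)
    hq.1.aestronglyMeasurable, hq.2.2]
  simp

lemma isDensity_of_integral {q : Ω → ℝ} (hm : Measurable q) (h0 : ∀ r, 0 ≤ q r)
    (hi : Integrable q μ) (h1 : ∫ r, q r ∂μ = 1) : IsDensity μ q := by
  refine ⟨hm, h0, ?_⟩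
  rw [← ofReal_integral_eq_lintegral_ofReal hi (Eventually.of_forall h0), h1]
  simp

lemma Standing.finite_entropy (hst : Standing μ β β' X p₀ b₀) {q : Ω → ℝ} (hq : IsDensity μ q)
    (hH : Hfun μ β q ≠ ⊤) : (∀ᵐ r ∂μ, β r (q r) ≠ ⊤) ∧
      Integrable (fun r => (β r (q r)).toReal) μ ∧
      Hfun μ β q = ((∫ r, (β r (q r)).toReal ∂μ : ℝ) : EReal) := by
  have hb : Hfun μ β q ≠ ⊥ := ne_bot_of_le_ne_bot EReal.zero_ne_bot (hst.Hnonneg q hq)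
  obtain ⟨h1, -, h3⟩ := eInt_real (hst.measurable_comp hq.1 hq.2.1).aemeasurable hb hH
  refine ⟨h1, h3, ?_⟩
  rw [← eInt_coe h3]
  refine eInt_congr ?_
  filter_upwards [h1] with r hr
  exact ((hst.fibre r).coe_toReal hr).symm

lemma Hfun_le_of_le {q g : Ω → ℝ} (hg : Integrable g μ)
    (h : ∀ᵐ r ∂μ, β r (q r) ≤ (g r : EReal)) : Hfun μ β q ≤ ((∫ r, g r ∂μ : ℝ) : EReal) := by
  rw [← eInt_coe hg]
  exact eInt_mono h

lemma xInt_eq {q : Ω → ℝ} (h : Integrable (fun r => X r * q r) μ) :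
    xInt μ X q = ((∫ r, X r * q r ∂μ : ℝ) : EReal) := eInt_coe h

lemma integrable_of_xInt {q : Ω → ℝ} (hX : Measurable X) (hq : Measurable q)
    (hb : xInt μ X q ≠ ⊥) (ht : xInt μ X q ≠ ⊤) : Integrable (fun r => X r * q r) μ := by
  have := (eInt_real (f := fun r => ((X r * q r : ℝ) : EReal))
    (hX.mul hq).aemeasurable.coe_real_ereal hb ht).2.2
  simpa only [EReal.toReal_coe] using this

lemma Standing.integrable_payoff₀ (hst : Standing μ β β' X p₀ b₀) :
    Integrable (fun r => X r * p₀ r) μ :=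
  integrable_of_xInt hst.Xmeas hst.dens₀.1 (by simp [hst.payoff₀]) (by simp [hst.payoff₀])

lemma Standing.integral_payoff₀ (hst : Standing μ β β' X p₀ b₀) :
    ∫ r, X r * p₀ r ∂μ = b₀ := by
  have := xInt_eq hst.integrable_payoff₀
  rw [hst.payoff₀] at this
  exact_mod_cast this.symm

lemma Standing.entropy₀ (hst : Standing μ β β' X p₀ b₀) : (∀ᵐ r ∂μ, β r (p₀ r) ≠ ⊤) ∧
      Integrable (fun r => (β r (p₀ r)).toReal) μ ∧ ∫ r, (β r (p₀ r)).toReal ∂μ = 0 := by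
  obtain ⟨h1, h2, h3⟩ := hst.finite_entropy hst.dens₀ (by simp [hst.H₀])
  refine ⟨h1, h2, ?_⟩
  rw [hst.H₀] at h3
  exact_mod_cast h3.symm

/-- Nonnegative functions with integrable mass and payoff, together with an integrable upper bound
`g` for their entropy integrand. -/
structure Admissible (μ : Measure Ω) (β : Ω → ℝ → EReal) (X q g : Ω → ℝ) : Prop where
  meas : Measurable q
  nonneg : ∀ r, 0 ≤ q r
  integrable : Integrable q μ
  integrable_payoff : Integrable (fun r => X r * q r) μ
  integrable_bound : Integrable g μ
  le_bound : ∀ᵐ r ∂μ, β r (q r) ≤ (g r : EReal)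

lemma Admissible.combo (hst : Standing μ β β' X p₀ b₀) {q g q' g' : Ω → ℝ}
    (h : Admissible μ β X q g) (h' : Admissible μ β X q' g') {a b : ℝ} (ha : 0 ≤ a) (hb : 0 ≤ b)
    (hab : a + b = 1) : Admissible μ β X (fun r => a * q r + b * q' r)
      (fun r => a * g r + b * g' r) where
  meas := (h.meas.const_mul a).add (h'.meas.const_mul b)
  nonneg r := add_nonneg (mul_nonneg ha (h.nonneg r)) (mul_nonneg hb (h'.nonneg r))
  integrable := (h.integrable.const_mul a).add (h'.integrable.const_mul b)
  integrable_payoff := by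
    refine ((h.integrable_payoff.const_mul a).add (h'.integrable_payoff.const_mul b)).congr
      (Eventually.of_forall fun r => ?_)
    simp only [Pi.add_apply]
    ring
  integrable_bound := (h.integrable_bound.const_mul a).add (h'.integrable_bound.const_mul b)
  le_bound := by
    filter_upwards [h.le_bound, h'.le_bound] with r hr hr'
    exact (hst.fibre r).le_combo (h.nonneg r) (h'.nonneg r) hr hr' ha hb hab

lemma integral_combo {u v : Ω → ℝ} (hu : Integrable u μ) (hv : Integrable v μ) (a b : ℝ) :
    ∫ r, (a * u r + b * v r) ∂μ = a * ∫ r, u r ∂μ + b * ∫ r, v r ∂μ := by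
  rw [integral_add (hu.const_mul a) (hv.const_mul b), integral_const_mul, integral_const_mul]

lemma Admissible.payoff_combo {q g q' g' : Ω → ℝ}
    (h : Admissible μ β X q g) (h' : Admissible μ β X q' g') (a b : ℝ) :
    ∫ r, X r * (a * q r + b * q' r) ∂μ = a * ∫ r, X r * q r ∂μ + b * ∫ r, X r * q' r ∂μ := by
  rw [← integral_combo h.integrable_payoff h'.integrable_payoff]
  congr 1 with r
  ring

lemma Admissible.isDensity {q g : Ω → ℝ} (h : Admissible μ β X q g) (h1 : ∫ r, q r ∂μ = 1) :
    IsDensity μ q :=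
  isDensity_of_integral h.meas h.nonneg h.integrable h1

lemma Standing.admissible (hst : Standing μ β β' X p₀ b₀) {q : Ω → ℝ} (hq : IsDensity μ q)
    (hH : Hfun μ β q ≠ ⊤) (hX : Integrable (fun r => X r * q r) μ) :
    Admissible μ β X q fun r => (β r (q r)).toReal := by
  obtain ⟨h1, h2, -⟩ := hst.finite_entropy hq hH
  refine ⟨hq.1, hq.2.1, hq.integrable, hX, h2, ?_⟩
  filter_upwards [h1] with r hr
  exact ((hst.fibre r).coe_toReal hr).ge

lemma Standing.admissible₀ (hst : Standing μ β β' X p₀ b₀) :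
    Admissible μ β X p₀ fun r => (β r (p₀ r)).toReal :=
  hst.admissible hst.dens₀ (by simp [hst.H₀]) hst.integrable_payoff₀

/-- Mixing with `p₀` moves the payoff up to a prescribed value `b < b₀` at the expense of scaling
the entropy. -/
lemma Standing.Ffun_le_of_admissible (hst : Standing μ β β' X p₀ b₀) {q g : Ω → ℝ}
    (h : Admissible μ β X q g) (h1 : ∫ r, q r ∂μ = 1) {b : ℝ}
    (hqb : ∫ r, X r * q r ∂μ < b) (hb : b < b₀) :
    Ffun μ β X b ≤ (((b₀ - b) / (b₀ - ∫ r, X r * q r ∂μ) * ∫ r, g r ∂μ : ℝ) : EReal) := by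
  set c := ∫ r, X r * q r ∂μ with hc
  set t := (b₀ - b) / (b₀ - c) with ht
  have hpos : 0 < b₀ - c := by linarith
  have ht0 : 0 ≤ t := div_nonneg (by linarith) hpos.le
  have ht1 : 0 ≤ 1 - t := by rw [sub_nonneg, ht, div_le_one hpos]; linarith
  have hm := h.combo hst hst.admissible₀ ht0 ht1 (by ring)
  have hd := hm.isDensity (by
    rw [integral_combo h.integrable hst.dens₀.integrable, h1, hst.dens₀.integral_eq_one]; ring)
  have hx := xInt_eq hm.integrable_payoff
  rw [h.payoff_combo hst.admissible₀, ← hc, hst.integral_payoff₀] at hx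
  have htc : t * c + (1 - t) * b₀ = b := by
    have : t * (b₀ - c) = b₀ - b := div_mul_cancel₀ _ hpos.ne'
    linarith
  rw [htc] at hx
  refine (iInf_le _ ⟨_, hd, hx⟩).trans ((Hfun_le_of_le hm.integrable_bound hm.le_bound).trans ?_)
  rw [integral_combo h.integrable_bound hst.entropy₀.2.1, hst.entropy₀.2.2]
  simp

/-- A density of finite entropy whose payoff integral is `-∞` or undefined can be truncated into
densities with arbitrarily low payoff and uniformly bounded entropy. -/
lemma Standing.exists_admissible_payoff_lt (hst : Standing μ β β' X p₀ b₀) {q : Ω → ℝ}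
    (hq : IsDensity μ q) (hH : Hfun μ β q ≠ ⊤) (hX : xInt μ X q = ⊥) :
    ∃ g : Ω → ℝ, ∀ R : ℝ, ∃ q', Admissible μ β X q' g ∧ ∫ r, q' r ∂μ = 1 ∧
      ∫ r, X r * q' r ∂μ < R := by
  have := hst.sigma
  obtain ⟨hqt, hqi, -⟩ := hst.finite_entropy hq hH
  obtain ⟨h0t, h0i, -⟩ := hst.entropy₀
  have hp₀ := hst.dens₀
  set u : Ω → ℝ := fun r => max (q r - p₀ r) 0 with hu
  set w : Ω → ℝ := fun r => max (p₀ r - q r) 0 with hw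
  have hum : Measurable u := (hq.1.sub hp₀.1).max measurable_const
  have hwm : Measurable w := (hp₀.1.sub hq.1).max measurable_const
  have hu0 : ∀ r, 0 ≤ u r := fun r => le_max_right _ _
  have hw0 : ∀ r, 0 ≤ w r := fun r => le_max_right _ _
  have hwp : ∀ r, w r ≤ p₀ r := fun r => max_le (by linarith [hq.2.1 r]) (hp₀.2.1 r)
  have hui : Integrable u μ := (hq.integrable.sub hp₀.integrable).pos_part
  have hwi : Integrable w μ := (hp₀.integrable.sub hq.integrable).pos_part
  have huw : ∀ r, u r - w r = q r - p₀ r := fun r => by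
    simp only [hu, hw]
    rcases le_total (q r) (p₀ r) with h | h
    · rw [max_eq_right (by linarith), max_eq_left (by linarith)]; ring
    · rw [max_eq_left (by linarith), max_eq_right (by linarith)]; ring
  have hmass : ∫ r, u r ∂μ = ∫ r, w r ∂μ := by
    have h := integral_sub hui hwi
    simp only [huw] at h
    rw [integral_sub hq.integrable hp₀.integrable, hq.integral_eq_one, hp₀.integral_eq_one] at h
    linarith
  have hXw : Integrable (fun r => X r * w r) μ := by
    refine hst.integrable_payoff₀.mono (hst.Xmeas.mul hwm).aestronglyMeasurable
      (Eventually.of_forall fun r => ?_)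
    rw [norm_mul, norm_mul, Real.norm_of_nonneg (hw0 r), Real.norm_of_nonneg (hp₀.2.1 r)]
    exact mul_le_mul_of_nonneg_left (hwp r) (norm_nonneg _)
  let ν : Measure Ω := μ.withDensity fun r => ENNReal.ofReal (-(X r * u r))
  have : SigmaFinite ν := SigmaFinite.withDensity_ofReal _
  have hS : MeasurableSet {r | X r ≤ 0} := measurableSet_le hst.Xmeas measurable_const
  have hνtop : ν {r | X r ≤ 0} = ⊤ := by
    by_contra hfin
    have hind : ∀ r, {r | X r ≤ 0}.indicator (fun r => ENNReal.ofReal (-(X r * u r))) r =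
        ENNReal.ofReal (-(X r * u r)) := by
      intro r
      rw [indicator_apply_eq_self]
      intro h
      have h : 0 < X r := not_le.1 h
      exact ENNReal.ofReal_of_nonpos (by linarith [mul_nonneg h.le (hu0 r)])
    rw [withDensity_apply _ hS, ← lintegral_indicator hS, lintegral_congr hind] at hfin
    have hneg : ∫⁻ r, ENNReal.ofReal (-(X r * q r)) ∂μ ≠ ⊤ := by
      have hle : ∀ r, ENNReal.ofReal (-(X r * q r)) ≤
          ENNReal.ofReal (-(X r * u r)) + ENNReal.ofReal ‖X r * p₀ r‖ := by
        intro r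
        refine le_trans (ENNReal.ofReal_le_ofReal ?_) ENNReal.ofReal_add_le
        have h1 : ‖X r * (p₀ r - w r)‖ ≤ ‖X r * p₀ r‖ := by
          rw [norm_mul, norm_mul, Real.norm_of_nonneg (hp₀.2.1 r),
            Real.norm_of_nonneg (sub_nonneg.2 (hwp r))]
          exact mul_le_mul_of_nonneg_left (by linarith [hw0 r]) (norm_nonneg _)
        have h2 := neg_le_abs (X r * (p₀ r - w r))
        rw [← Real.norm_eq_abs] at h2
        have h3 : q r = p₀ r + u r - w r := by linarith [huw r]
        rw [h3]
        linarith
      refine ne_top_of_le_ne_top ?_ (lintegral_mono hle)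
      have hm : Measurable fun r => ENNReal.ofReal ‖X r * p₀ r‖ :=
        (hst.Xmeas.mul hp₀.1).norm.ennreal_ofReal
      rw [lintegral_add_right _ hm]
      exact ENNReal.add_ne_top.2 ⟨hfin, hst.integrable_payoff₀.norm.lintegral_lt_top.ne⟩
    have : xInt μ X q ≠ ⊥ := by
      unfold xInt
      rw [eInt_coe_def, ← EReal.coe_ennreal_toReal hneg]
      generalize ∫⁻ r, ENNReal.ofReal (X r * q r) ∂μ = a
      rcases eq_or_ne a ⊤ with rfl | ha
      · simp
      · rw [← EReal.coe_ennreal_toReal ha, ← EReal.coe_sub]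
        exact EReal.coe_ne_bot _
    exact this hX
  refine ⟨fun r => |(β r (q r)).toReal| + |(β r (p₀ r)).toReal|, fun R => ?_⟩
  set C := ∫ r, ‖X r * w r‖ ∂μ with hC
  obtain ⟨E, hE, hES, hEl, hEt⟩ := Measure.exists_subset_measure_lt_top (μ := ν)
    (r := ENNReal.ofReal (b₀ + C - R)) hS (by rw [hνtop]; exact ENNReal.ofReal_lt_top)
  rw [withDensity_apply _ hE] at hEl hEt
  have hEneg : ∀ r ∈ E, 0 ≤ -(X r * u r) := fun r hr => by
    have : X r ≤ 0 := hES hr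
    linarith [mul_nonneg (neg_nonneg.2 this) (hu0 r)]
  have hEnegae : 0 ≤ᵐ[μ.restrict E] fun r => -(X r * u r) := by
    filter_upwards [ae_restrict_mem hE] with r hr using hEneg r hr
  have hXum : Measurable fun r => -(X r * u r) := (hst.Xmeas.mul hum).neg
  have hEi : Integrable (fun r => -(X r * u r)) (μ.restrict E) :=
    (lintegral_ofReal_ne_top_iff_integrable hXum.aestronglyMeasurable hEnegae).1 hEt.ne
  have hEi' : IntegrableOn (fun r => X r * u r) E μ := by simpa [IntegrableOn] using hEi.neg
  rw [← ofReal_integral_eq_lintegral_ofReal hEi hEnegae, integral_neg] at hEl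
  have hElt := (ENNReal.ofReal_lt_ofReal_iff'.1 hEl).1
  set s := (∫ r in E, u r ∂μ) / ∫ r, w r ∂μ with hs
  have hEu0 : 0 ≤ ∫ r in E, u r ∂μ := setIntegral_nonneg hE fun r _ => hu0 r
  have hEuw : ∫ r in E, u r ∂μ ≤ ∫ r, w r ∂μ := by
    rw [← hmass]
    exact setIntegral_le_integral hui (Eventually.of_forall hu0)
  have hw0' : 0 ≤ ∫ r, w r ∂μ := integral_nonneg hw0
  have hs0 : 0 ≤ s := div_nonneg hEu0 hw0'
  have hs1 : s ≤ 1 := div_le_one_of_le₀ hEuw hw0'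
  have hsw : s * ∫ r, w r ∂μ = ∫ r in E, u r ∂μ := by
    rcases hw0'.eq_or_lt with h | h
    · rw [← h, mul_zero]
      linarith
    · exact div_mul_cancel₀ _ h.ne'
  have hiu : Integrable (E.indicator u) μ := hui.indicator hE
  have hXiu : Integrable (E.indicator fun r => X r * u r) μ := hEi'.integrable_indicator hE
  have hXeq : ∀ r, X r * (p₀ r + E.indicator u r - s * w r) =
      X r * p₀ r + E.indicator (fun r => X r * u r) r - s * (X r * w r) := by
    intro r
    by_cases h : r ∈ E <;> simp only [h, indicator_of_mem, indicator_of_notMem,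
      not_false_eq_true] <;> ring
  have hpt : ∀ r, p₀ r + E.indicator u r - s * w r = q r ∨
      p₀ r + E.indicator u r - s * w r = p₀ r ∨
      p₀ r + E.indicator u r - s * w r = s * q r + (1 - s) * p₀ r := by
    intro r
    rcases le_total (q r) (p₀ r) with h | h
    · right; right
      have h1 : u r = 0 := max_eq_right (by linarith)
      have h2 : w r = p₀ r - q r := max_eq_left (by linarith)
      have h3 : E.indicator u r = 0 := by
        by_cases hr : r ∈ E <;> simp [hr, h1]
      rw [h2, h3]
      ring
    · have h1 : u r = q r - p₀ r := max_eq_left (by linarith)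
      have h2 : w r = 0 := max_eq_right (by linarith)
      by_cases hr : r ∈ E
      · left
        simp [hr, h1, h2]
      · right; left
        simp [hr, h2]
  refine ⟨fun r => p₀ r + E.indicator u r - s * w r, ?_, ?_, ?_⟩
  · refine ⟨(hp₀.1.add (hum.indicator hE)).sub (hwm.const_mul s), fun r => ?_,
      (hp₀.integrable.add hiu).sub (hwi.const_mul s), ?_, hqi.abs.add h0i.abs, ?_⟩
    · rcases hpt r with h | h | h <;> rw [h]
      · exact hq.2.1 r
      · exact hp₀.2.1 r
      · exact add_nonneg (mul_nonneg hs0 (hq.2.1 r))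
          (mul_nonneg (sub_nonneg.2 hs1) (hp₀.2.1 r))
    · simp only [hXeq]
      exact (hst.integrable_payoff₀.add hXiu).sub (hXw.const_mul s)
    · filter_upwards [hqt, h0t] with r hr hr'
      have h1 := le_abs_self (β r (q r)).toReal
      have h2 := le_abs_self (β r (p₀ r)).toReal
      have h3 := abs_nonneg (β r (q r)).toReal
      have h4 := abs_nonneg (β r (p₀ r)).toReal
      rcases hpt r with h | h | h <;> rw [h]
      · refine ((hst.fibre r).coe_toReal hr).ge.trans ?_
        exact_mod_cast (by linarith)
      · refine ((hst.fibre r).coe_toReal hr').ge.trans ?_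
        exact_mod_cast (by linarith)
      · refine ((hst.fibre r).le_combo (hq.2.1 r) (hp₀.2.1 r)
          ((hst.fibre r).coe_toReal hr).ge ((hst.fibre r).coe_toReal hr').ge hs0
          (sub_nonneg.2 hs1) (by ring)).trans ?_
        exact_mod_cast (by nlinarith [mul_nonneg hs0 h4, mul_nonneg (sub_nonneg.2 hs1) h3])
  · have h1 : Integrable (fun r => p₀ r + E.indicator u r) μ := hp₀.integrable.add hiu
    rw [integral_sub h1 (hwi.const_mul s), integral_add hp₀.integrable hiu,
      integral_indicator hE, integral_const_mul, hsw,
      hp₀.integral_eq_one]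
    ring
  · simp only [hXeq]
    have h0 : Integrable (fun r => X r * p₀ r + E.indicator (fun r => X r * u r) r) μ :=
      hst.integrable_payoff₀.add hXiu
    rw [integral_sub h0 (hXw.const_mul s), integral_add hst.integrable_payoff₀ hXiu,
      integral_indicator hE, integral_const_mul,
      hst.integral_payoff₀]
    have h1 : -C ≤ s * ∫ r, X r * w r ∂μ := by
      have h2 : |∫ r, X r * w r ∂μ| ≤ C := by
        rw [← Real.norm_eq_abs]
        exact norm_integral_le_integral_norm _
      have h3 := neg_abs_le (∫ r, X r * w r ∂μ)
      nlinarith [abs_nonneg (∫ r, X r * w r ∂μ)]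
    linarith

/-- Below `k_max`, the payoff of every density in the entropy ball stays above some level
strictly greater than the essential infimum of `X`. -/
lemma Standing.exists_lower_bound (hst : Standing μ β β' X p₀ b₀) {k : ℝ} (hk0 : 0 < k)
    (hkmax : (k : EReal) < kmax μ β X b₀) :
    ∃ b₁ : ℝ, essInfX μ X < b₁ ∧ (b₁ : EReal) ≤ Vfun μ β X k := by
  obtain ⟨⟨b₁, hmb, hbb⟩, hF⟩ := lt_iSup_iff.1 hkmax
  refine ⟨b₁, hmb, le_iInf fun ⟨q, hq, hH⟩ => ?_⟩
  by_contra hlt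
  have hlt : xInt μ X q < b₁ := not_le.1 hlt
  have hHt : Hfun μ β q ≠ ⊤ := ne_top_of_le_ne_top (EReal.coe_ne_top k) hH
  suffices Ffun μ β X b₁ ≤ (k : EReal) from absurd hF (not_lt.2 this)
  by_cases hbot : xInt μ X q = ⊥
  · obtain ⟨g, hg⟩ := hst.exists_admissible_payoff_lt hq hHt hbot
    set G := |∫ r, g r ∂μ|
    obtain ⟨q', hq', h1, hR⟩ := hg (min b₁ (b₀ - (b₀ - b₁) * G / k))
    have hc1 := hR.trans_le (min_le_left _ _)
    have hc2 := hR.trans_le (min_le_right _ _)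
    refine (hst.Ffun_le_of_admissible hq' h1 hc1 hbb).trans ?_
    have hpos : 0 < b₀ - ∫ r, X r * q' r ∂μ := by linarith
    have h3 : (b₀ - b₁) * G / k < b₀ - ∫ r, X r * q' r ∂μ := by linarith
    rw [div_lt_iff₀ hk0] at h3
    have h4 : (b₀ - b₁) * ∫ r, g r ∂μ ≤ (b₀ - b₁) * G :=
      mul_le_mul_of_nonneg_left (le_abs_self _) (by linarith)
    have h5 : (b₀ - b₁) / (b₀ - ∫ r, X r * q' r ∂μ) * ∫ r, g r ∂μ ≤ k := by
      rw [div_mul_eq_mul_div, div_le_iff₀ hpos]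
      linarith
    exact_mod_cast h5
  · have hX := integrable_of_xInt hst.Xmeas hq.1 hbot (hlt.trans (EReal.coe_lt_top _)).ne
    rw [xInt_eq hX] at hlt
    have hlt : ∫ r, X r * q r ∂μ < b₁ := by exact_mod_cast hlt
    have hadm := hst.admissible hq hHt hX
    refine (hst.Ffun_le_of_admissible hadm hq.integral_eq_one hlt hbb).trans ?_
    have hHk : ∫ r, (β r (q r)).toReal ∂μ ≤ k := by
      rw [(hst.finite_entropy hq hHt).2.2] at hH
      exact_mod_cast hH
    have hpos : 0 < b₀ - ∫ r, X r * q r ∂μ := by linarith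
    have h5 : (b₀ - b₁) / (b₀ - ∫ r, X r * q r ∂μ) * ∫ r, (β r (q r)).toReal ∂μ ≤ k := by
      rw [div_mul_eq_mul_div, div_le_iff₀ hpos]
      nlinarith
    exact_mod_cast h5

lemma Standing.Vfun_le (hst : Standing μ β β' X p₀ b₀) {k : ℝ} (hk0 : 0 ≤ k) :
    Vfun μ β X k ≤ b₀ := by
  rw [← hst.payoff₀]
  exact iInf_le (fun p : {p : Ω → ℝ // IsDensity μ p ∧ Hfun μ β p ≤ (k : EReal)} => xInt μ X p.1)
    ⟨p₀, hst.dens₀, by rw [hst.H₀]; exact_mod_cast hk0⟩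

end Density

section Multiplier

variable {Ω : Type*} [MeasurableSpace Ω] {μ : Measure Ω} {β : Ω → ℝ → EReal} {β' : Ω → ℝ → ℝ}
  {X p₀ : Ω → ℝ} {b₀ : ℝ}

/-- Lagrange multipliers for the problem of minimising the payoff over the entropy ball. -/
lemma Standing.exists_multipliers (hst : Standing μ β β' X p₀ b₀) {p g : Ω → ℝ} {b k : ℝ}
    (hp : Admissible μ β X p g) (h1 : ∫ r, p r ∂μ = 1) (hXp : ∫ r, X r * p r ∂μ = b)
    (hg : ∫ r, g r ∂μ ≤ k)
    (hmin : ∀ q, IsDensity μ q → Hfun μ β q ≤ (k : EReal) → (b : EReal) ≤ xInt μ X q) :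
    ∃ α γ l : ℝ, (α ≠ 0 ∨ γ ≠ 0 ∨ l ≠ 0) ∧ 0 ≤ γ ∧ 0 ≤ l ∧ ∀ q g, Admissible μ β X q g →
      0 ≤ α * (∫ r, q r ∂μ - 1) + γ * (∫ r, X r * q r ∂μ - b) + l * (∫ r, g r ∂μ - k) := by
  let S : Set (ℝ × ℝ × ℝ) := {x | ∃ q g, Admissible μ β X q g ∧ ∫ r, q r ∂μ = 1 + x.1 ∧
    ∫ r, X r * q r ∂μ < b + x.2.1 ∧ ∫ r, g r ∂μ ≤ k + x.2.2}
  have hS : Convex ℝ S := by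
    rintro x ⟨q, g, h, e1, e2, e3⟩ y ⟨q', g', h', e1', e2', e3'⟩ s t hs ht hst'
    refine ⟨_, _, h.combo hst h' hs ht hst', ?_, ?_, ?_⟩
    · rw [integral_combo h.integrable h'.integrable, e1, e1']
      simp only [Prod.fst_add, Prod.smul_fst, smul_eq_mul]
      linear_combination hst'
    · rw [h.payoff_combo h']
      simp only [Prod.fst_add, Prod.snd_add, Prod.smul_fst, Prod.smul_snd, smul_eq_mul]
      have hb : s * b + t * b = b := by rw [← add_mul, hst', one_mul]
      rcases hs.eq_or_lt with rfl | hs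
      · have ht1 : t = 1 := by linarith
        subst ht1
        linarith
      · have := mul_lt_mul_of_pos_left e2 hs
        have := mul_le_mul_of_nonneg_left e2'.le ht
        linarith
    · rw [integral_combo h.integrable_bound h'.integrable_bound]
      simp only [Prod.snd_add, Prod.smul_snd, smul_eq_mul]
      have hk : s * k + t * k = k := by rw [← add_mul, hst', one_mul]
      have := mul_le_mul_of_nonneg_left e3 hs
      have := mul_le_mul_of_nonneg_left e3' ht
      linarith
  have hmem : ∀ c z : ℝ, 0 < c → 0 ≤ z → ((0, c, z) : ℝ × ℝ × ℝ) ∈ S := fun c z hc hz =>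
    ⟨p, g, hp, by simpa using h1, by simp [hXp, hc], hg.trans (by simpa using hz)⟩
  have h0 : (0 : ℝ × ℝ × ℝ) ∉ S := by
    rintro ⟨q, g, h, e1, e2, e3⟩
    simp only [Prod.fst_zero, Prod.snd_zero, add_zero] at e1 e2 e3
    have := hmin q (h.isDensity e1) ((Hfun_le_of_le h.integrable_bound h.le_bound).trans
      (by exact_mod_cast e3))
    rw [xInt_eq h.integrable_payoff] at this
    exact absurd (by exact_mod_cast this) (not_le.2 e2)
  obtain ⟨f, hf0, hf⟩ := exists_ne_zero_forall_nonneg hS ⟨_, hmem 1 0 one_pos le_rfl⟩ h0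
  have hfx : ∀ a c z : ℝ, f (a, c, z) = a * f (1, 0, 0) + c * f (0, 1, 0) + z * f (0, 0, 1) := by
    intro a c z
    have : ((a, c, z) : ℝ × ℝ × ℝ) = a • (1, 0, 0) + c • (0, 1, 0) + z • (0, 0, 1) := by simp
    rw [this, map_add, map_add, map_smul, map_smul, map_smul]
    simp only [smul_eq_mul]
  generalize f (1, 0, 0) = α at hfx
  generalize f (0, 1, 0) = γ at hfx
  generalize f (0, 0, 1) = l at hfx
  have hγ : 0 ≤ γ := by
    have := hf _ (hmem 1 0 one_pos le_rfl)
    rw [hfx] at this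
    linarith
  refine ⟨α, γ, l, ?_, hγ, ?_, fun q g h => ?_⟩
  · by_contra! hcon
    obtain ⟨rfl, rfl, rfl⟩ := hcon
    refine hf0 (LinearMap.ext fun x => ?_)
    rw [show x = (x.1, x.2.1, x.2.2) from rfl, hfx]
    simp
  · by_contra! hl
    have := hf _ (hmem 1 ((γ + 1) / (-l)) one_pos (div_nonneg (by linarith) (by linarith)))
    rw [hfx] at this
    have h2 : (γ + 1) / (-l) * l = -(γ + 1) := by
      rw [div_neg, neg_mul, div_mul_cancel₀ _ hl.ne]
    linarith
  · by_contra! hneg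
    set v := α * (∫ r, q r ∂μ - 1) + γ * (∫ r, X r * q r ∂μ - b) + l * (∫ r, g r ∂μ - k) with hv
    have hc : 0 < -v / (γ + 1) := div_pos (by linarith) (by linarith)
    have := hf (∫ r, q r ∂μ - 1, ∫ r, X r * q r ∂μ - b + -v / (γ + 1), ∫ r, g r ∂μ - k)
      ⟨q, g, h, by ring, by simp only; linarith, by simp only; linarith⟩
    rw [hfx] at this
    have h2 : -v / (γ + 1) * (γ + 1) = -v := div_mul_cancel₀ _ (by linarith)
    nlinarith

lemma integral_piecewise_sub {u v : Ω → ℝ} {B : Set Ω} [DecidablePred (· ∈ B)]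
    (hB : MeasurableSet B) (hu : IntegrableOn u B μ) (hv : Integrable v μ) :
    ∫ r, B.piecewise u v r ∂μ = ∫ r, v r ∂μ + ∫ r in B, (u r - v r) ∂μ := by
  rw [integral_piecewise hB hu hv.integrableOn, integral_sub hu hv.integrableOn,
    ← integral_add_compl hB hv]
  ring

/-- A minimiser of an integral functional over admissible functions minimises its integrand
pointwise. -/
lemma Standing.ae_le_of_forall_admissible (hst : Standing μ β β' X p₀ b₀) {p g : Ω → ℝ}
    (hp : Admissible μ β X p g) (hgm : Measurable g) {α γ l : ℝ}
    (hmin : ∀ q h, Admissible μ β X q h → α * ∫ r, p r ∂μ + γ * ∫ r, X r * p r ∂μ +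
      l * ∫ r, g r ∂μ ≤ α * ∫ r, q r ∂μ + γ * ∫ r, X r * q r ∂μ + l * ∫ r, h r ∂μ)
    {v : Ω → ℝ} (hv : Measurable v) (hv0 : ∀ r, 0 < v r) :
    ∀ᵐ r ∂μ, 0 ≤ (α + γ * X r) * (v r - p r) + l * ((β r (v r)).toReal - g r) := by
  classical
  have := hst.sigma
  have hβv : Measurable fun r => (β r (v r)).toReal :=
    (hst.measurable_comp hv fun r => (hv0 r).le).ereal_toReal
  have hX := hst.Xmeas
  have hpm := hp.meas
  set d : Ω → ℝ := fun r => (α + γ * X r) * (v r - p r) + l * ((β r (v r)).toReal - g r) with hd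
  have hdm : Measurable d := by fun_prop
  have hA : MeasurableSet {r | d r < 0} := measurableSet_lt hdm measurable_const
  by_contra hcon
  have hA0 : μ {r | d r < 0} ≠ 0 := by
    simpa only [ae_iff, not_le] using hcon
  obtain ⟨B, hBA, hB, hB0, hBt, C, hC⟩ := exists_subset_bounded hA hA0
    (u := fun r => |v r| + |X r * v r| + |(β r (v r)).toReal|) (by fun_prop)
  have hint : ∀ w : Ω → ℝ, Measurable w →
      (∀ r, |w r| ≤ |v r| + |X r * v r| + |(β r (v r)).toReal|) → IntegrableOn w B μ := by
    intro w hw hle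
    refine IntegrableOn.of_bound (lt_top_iff_ne_top.2 hBt) hw.aestronglyMeasurable C ?_
    filter_upwards [ae_restrict_mem hB] with r hr
    exact (hle r).trans ((le_abs_self _).trans (hC r hr))
  have i1 := hint v hv fun r => by
    linarith [abs_nonneg (X r * v r), abs_nonneg (β r (v r)).toReal]
  have i2 := hint (fun r => X r * v r) (hX.mul hv) fun r => by
    linarith [abs_nonneg (v r), abs_nonneg (β r (v r)).toReal]
  have i3 := hint _ hβv fun r => by linarith [abs_nonneg (v r), abs_nonneg (X r * v r)]
  have hXq : ∀ r, X r * B.piecewise v p r =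
      B.piecewise (fun r => X r * v r) (fun r => X r * p r) r := by
    intro r
    by_cases hr : r ∈ B <;> simp [hr]
  have hq : Admissible μ β X (B.piecewise v p) (B.piecewise (fun r => (β r (v r)).toReal) g) := by
    refine ⟨hv.piecewise hB hpm, fun r => ?_, Integrable.piecewise hB i1 hp.integrable.integrableOn, ?_,
      Integrable.piecewise hB i3 hp.integrable_bound.integrableOn, ?_⟩
    · by_cases hr : r ∈ B <;> simp [hr, (hv0 r).le, hp.nonneg r]
    · simp only [hXq]
      exact Integrable.piecewise hB i2 hp.integrable_payoff.integrableOn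
    · filter_upwards [hp.le_bound] with r h
      by_cases hr : r ∈ B
      · simpa [hr] using ((hst.fibre r).coe_toReal (hst.betaFin r _ (hv0 r))).ge
      · simpa [hr] using h
  have hle := hmin _ _ hq
  simp only [hXq] at hle
  rw [integral_piecewise_sub hB i1 hp.integrable, integral_piecewise_sub hB i2 hp.integrable_payoff,
    integral_piecewise_sub hB i3 hp.integrable_bound] at hle
  have j1 : Integrable (fun r => v r - p r) (μ.restrict B) := i1.sub hp.integrable.integrableOn
  have j2 : Integrable (fun r => X r * v r - X r * p r) (μ.restrict B) :=
    i2.sub hp.integrable_payoff.integrableOn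
  have j3 : Integrable (fun r => (β r (v r)).toReal - g r) (μ.restrict B) :=
    i3.sub hp.integrable_bound.integrableOn
  have hde : ∀ r, d r = (α * (v r - p r) + γ * (X r * v r - X r * p r)) +
      l * ((β r (v r)).toReal - g r) := fun r => by
    simp only [hd]
    ring
  have j12 : Integrable (fun r => α * (v r - p r) + γ * (X r * v r - X r * p r)) (μ.restrict B) :=
    (j1.const_mul α).add (j2.const_mul γ)
  have hdi : ∫ r in B, d r ∂μ = α * ∫ r in B, (v r - p r) ∂μ +
      γ * ∫ r in B, (X r * v r - X r * p r) ∂μ +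
      l * ∫ r in B, ((β r (v r)).toReal - g r) ∂μ := by
    simp only [hde]
    rw [integral_add j12 (j3.const_mul l), integral_combo j1 j2, integral_const_mul]
  have hdint : IntegrableOn d B μ := by
    have : Integrable (fun r => (α * (v r - p r) + γ * (X r * v r - X r * p r)) +
      l * ((β r (v r)).toReal - g r)) (μ.restrict B) := j12.add (j3.const_mul l)
    exact this.congr (Eventually.of_forall fun r => (hde r).symm)
  have hpos : 0 < ∫ r in B, -d r ∂μ := by
    rw [setIntegral_pos_iff_support_of_nonneg_ae (f := fun r => -d r) _ hdint.neg]
    · refine (pos_iff_ne_zero.2 hB0).trans_le (measure_mono fun r hr => ⟨?_, hr⟩)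
      have : d r < 0 := hBA hr
      simp [this.ne]
    · filter_upwards [ae_restrict_mem hB] with r hr
      have : d r < 0 := hBA hr
      simp [this.le]
  rw [integral_neg] at hpos
  linarith

end Multiplier

section Optimality

variable {Ω : Type*} [MeasurableSpace Ω] {μ : Measure Ω} {β : Ω → ℝ → EReal} {β' : Ω → ℝ → ℝ}
  {ψ : Ω → ℝ → ℝ} {X p₀ : Ω → ℝ} {b₀ k θ₁ θ₂ : ℝ}

lemma ConvexFibre.isSubgradient_of_rat {f : ℝ → EReal} {f' : ℝ → ℝ} (hf : ConvexFibre f f')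
    {s₀ τ : ℝ} (hs₀ : 0 ≤ s₀) (ht : f s₀ ≠ ⊤)
    (h : ∀ q : ℚ, 0 < (q : ℝ) → (f s₀).toReal + τ * (q - s₀) ≤ (f q).toReal) :
    IsSubgradient f s₀ τ := by
  refine ⟨hs₀, ht, fun s hs => ?_⟩
  by_contra! hlt
  have hc : ContinuousAt (fun t => (f s₀).toReal + τ * (t - s₀)) s := by fun_prop
  have hev := ((hf.hasDerivAt s hs).continuousAt.eventually_lt hc hlt).and (lt_mem_nhds hs)
  obtain ⟨U, hU, hUo, hsU⟩ := mem_nhds_iff.1 hev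
  obtain ⟨q, hq⟩ := Rat.denseRange_cast.exists_mem_open hUo ⟨s, hsU⟩
  exact absurd (h q (hU hq).2) (not_le.2 (hU hq).1)

/-- The payoff of an optimal density is a real number strictly above the essential infimum. -/
lemma Standing.integrable_of_optimal (hst : Standing μ β β' X p₀ b₀) (hk0 : 0 < k)
    (hkmax : (k : EReal) < kmax μ β X b₀) {p : Ω → ℝ} (hm : Measurable p)
    (hV : xInt μ X p = Vfun μ β X k) :
    Integrable (fun r => X r * p r) μ ∧ ¬ ∀ᵐ r ∂μ, ∫ r, X r * p r ∂μ ≤ X r := by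
  obtain ⟨b₁, hb₁, hle⟩ := hst.exists_lower_bound hk0 hkmax
  have hi : Integrable (fun r => X r * p r) μ := by
    refine integrable_of_xInt hst.Xmeas hm ?_ ?_ <;> rw [hV]
    · exact ne_bot_of_le_ne_bot (EReal.coe_ne_bot _) hle
    · exact ne_top_of_le_ne_top (EReal.coe_ne_top _) (hst.Vfun_le hk0.le)
  refine ⟨hi, fun hcon => ?_⟩
  rw [← hV, xInt_eq hi] at hle
  refine absurd (hb₁.trans_le hle) (not_lt.2 (le_essInf_of_ae_le _ ?_))
  filter_upwards [hcon] with r hr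
  exact_mod_cast hr

lemma Standing.exists_subgradient_of_optimal (hst : Standing μ β β' X p₀ b₀) (hk0 : 0 < k)
    (hkmax : (k : EReal) < kmax μ β X b₀) {p : Ω → ℝ} (hp : IsDensity μ p)
    (hH : Hfun μ β p ≤ (k : EReal)) (hV : xInt μ X p = Vfun μ β X k) :
    ∃ θ₁ θ₂ : ℝ, θ₂ < 0 ∧ (∀ᵐ r ∂μ, IsSubgradient (β r) (p r) (θ₁ + θ₂ * X r)) ∧
      Hfun μ β p = (k : EReal) := by
  have hHt : Hfun μ β p ≠ ⊤ := ne_top_of_le_ne_top (EReal.coe_ne_top k) hH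
  obtain ⟨hpt, hgi, hHe⟩ := hst.finite_entropy hp hHt
  obtain ⟨hXi, hess⟩ := hst.integrable_of_optimal hk0 hkmax hp.1 hV
  have hadm := hst.admissible hp hHt hXi
  have hp1 := hp.integral_eq_one
  rw [hHe] at hH
  have hgk : ∫ r, (β r (p r)).toReal ∂μ ≤ k := by exact_mod_cast hH
  have hgm : Measurable fun r => (β r (p r)).toReal := (hst.measurable_comp hp.1 hp.2.1).ereal_toReal
  set g : Ω → ℝ := fun r => (β r (p r)).toReal with hg
  set b := ∫ r, X r * p r ∂μ with hb
  obtain ⟨α, γ, l, hne, hγ, hl, hmul⟩ := hst.exists_multipliers hadm hp1 rfl hgk fun q hq hqk => by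
    rw [← hb, ← xInt_eq hXi, hV]
    exact iInf_le (fun q : {q : Ω → ℝ // IsDensity μ q ∧ Hfun μ β q ≤ (k : EReal)} =>
      xInt μ X q.1) ⟨q, hq, hqk⟩
  have hself := hmul p g hadm
  have hlk : l * (∫ r, g r ∂μ - k) = 0 := by
    refine le_antisymm (mul_nonpos_of_nonneg_of_nonpos hl (by linarith)) ?_
    rw [hp1, ← hb] at hself
    linarith
  have hloc := fun {v : Ω → ℝ} (hv : Measurable v) (hv0 : ∀ r, 0 < v r) =>
    hst.ae_le_of_forall_admissible hadm hgm (α := α) (γ := γ) (l := l) (fun q h hq => by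
      have := hmul q h hq
      rw [hp1, ← hb]
      linarith) hv hv0
  have hl0 : 0 < l := by
    refine lt_of_le_of_ne hl fun hl0 => ?_
    subst hl0
    have h1 := hloc (v := fun r => p r + 1) (hp.1.add_const 1) fun r => by linarith [hp.2.1 r]
    have h2 := hloc (v := fun r => if 0 < p r then p r / 2 else 1)
      (Measurable.ite (measurableSet_lt measurable_const hp.1) (hp.1.div_const 2) measurable_const)
      fun r => by split_ifs <;> linarith
    have hz : ∀ᵐ r ∂μ, α * p r + γ * (X r * p r) = 0 := by
      filter_upwards [h1, h2] with r h1 h2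
      rcases (hp.2.1 r).eq_or_lt with h | h
      · rw [← h]
        ring
      · rw [if_pos h] at h2
        nlinarith
    have hαb : α + γ * b = 0 := by
      have := integral_combo hp.integrable hXi α γ
      rw [integral_congr_ae hz, hp1, ← hb] at this
      simpa using this.symm
    rcases hγ.eq_or_lt with rfl | hγ
    · simp only [zero_mul, add_zero] at hαb
      simp [hαb] at hne
    · refine hess ?_
      filter_upwards [h1] with r h1
      have : 0 ≤ γ * (X r - b) := by linarith
      linarith [nonneg_of_mul_nonneg_right this hγ]
  have hHk : ∫ r, g r ∂μ = k := by
    rcases mul_eq_zero.1 hlk with h | h <;> linarith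
  have hγ0 : 0 < γ := by
    refine lt_of_le_of_ne hγ fun hγ0 => ?_
    have := hmul _ _ hst.admissible₀
    rw [hst.dens₀.integral_eq_one, hst.entropy₀.2.2, ← hγ0] at this
    nlinarith
  refine ⟨-α / l, -γ / l, div_neg_of_neg_of_pos (by linarith) hl0, ?_, by rw [hHe, hHk]⟩
  have hrat : ∀ᵐ r ∂μ, ∀ q : ℚ, 0 < (q : ℝ) →
      0 ≤ (α + γ * X r) * (q - p r) + l * ((β r q).toReal - g r) := by
    refine ae_all_iff.2 fun q => ?_
    by_cases hq : 0 < (q : ℝ)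
    · filter_upwards [hloc (v := fun _ => (q : ℝ)) measurable_const fun _ => hq] with r hr _
      exact hr
    · exact Eventually.of_forall fun r h => absurd h hq
  filter_upwards [hrat, hpt] with r hr ht
  refine (hst.fibre r).isSubgradient_of_rat (hp.2.1 r) ht fun q hq => ?_
  have h1 := hr q hq
  have h2 : (-α / l + -γ / l * X r) * l = -(α + γ * X r) := by
    field_simp
    ring
  refine le_of_mul_le_mul_right ?_ hl0
  have h3 : ((β r (p r)).toReal + (-α / l + -γ / l * X r) * (q - p r)) * l =
      (β r (p r)).toReal * l + (-α / l + -γ / l * X r) * l * (q - p r) := by ring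
  rw [h3, h2]
  simp only [hg] at h1
  linarith

lemma Standing.eq_pFam_of_isSubgradient (hst : Standing μ β β' X p₀ b₀) (hψ : IsConjDeriv β β' ψ)
    {p : Ω → ℝ} (hs : ∀ᵐ r ∂μ, IsSubgradient (β r) (p r) (θ₁ + θ₂ * X r)) :
    p =ᵐ[μ] pFam ψ X θ₁ θ₂ := by
  filter_upwards [hs] with r hr
  exact ((hst.fibre r).eq_of_hasDerivAt_conj hr (hψ r _ (hr.lt_derivTop (hst.fibre r)))).symm

lemma Standing.isSubgradient_of_eq_pFam (hst : Standing μ β β' X p₀ b₀) (hψ : IsConjDeriv β β' ψ)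
    (hθ : (θ₁, θ₂) ∈ ThetaSet μ β β' X) {p : Ω → ℝ} (hp : p =ᵐ[μ] pFam ψ X θ₁ θ₂) :
    ∀ᵐ r ∂μ, IsSubgradient (β r) (p r) (θ₁ + θ₂ * X r) := by
  filter_upwards [hθ.2, hp] with r hr he
  obtain ⟨s, hs⟩ := (hst.fibre r).exists_isSubgradient hr
  rw [he, pFam, (hst.fibre r).eq_of_hasDerivAt_conj hs (hψ r _ hr)]
  exact hs

lemma Standing.Kfun_eq (hst : Standing μ β β' X p₀ b₀) {p : Ω → ℝ}
    (hs : ∀ᵐ r ∂μ, IsSubgradient (β r) (p r) (θ₁ + θ₂ * X r)) :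
    Kfun μ β X θ₁ θ₂ =
      eInt μ fun r => ((p r * (θ₁ + θ₂ * X r) - (β r (p r)).toReal : ℝ) : EReal) := by
  refine eInt_congr ?_
  filter_upwards [hs] with r hr
  exact hr.conj_eq (hst.fibre r)

lemma Standing.mem_ThetaSet (hst : Standing μ β β' X p₀ b₀) {p g : Ω → ℝ}
    (hp : Admissible μ β X p g) (hH : Integrable (fun r => (β r (p r)).toReal) μ)
    (hs : ∀ᵐ r ∂μ, IsSubgradient (β r) (p r) (θ₁ + θ₂ * X r)) :
    (θ₁, θ₂) ∈ ThetaSet μ β β' X := by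
  have hi : Integrable (fun r => p r * (θ₁ + θ₂ * X r) - (β r (p r)).toReal) μ := by
    refine (((hp.integrable.const_mul θ₁).add (hp.integrable_payoff.const_mul θ₂)).sub hH).congr
      (Eventually.of_forall fun r => ?_)
    simp only [Pi.add_apply, Pi.sub_apply]
    ring
  refine ⟨?_, ?_⟩
  · change Kfun μ β X θ₁ θ₂ < ⊤
    rw [hst.Kfun_eq hs, eInt_coe hi]
    exact EReal.coe_lt_top _
  · filter_upwards [hs] with r hr
    exact hr.lt_derivTop (hst.fibre r)

lemma Standing.integrable_payoff_of_Kfun (hst : Standing μ β β' X p₀ b₀)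
    (hθ : (θ₁, θ₂) ∈ ThetaSet μ β β' X) (hθ₂ : θ₂ < 0) {p : Ω → ℝ} (hp : IsDensity μ p)
    (hH : Integrable (fun r => (β r (p r)).toReal) μ)
    (hs : ∀ᵐ r ∂μ, IsSubgradient (β r) (p r) (θ₁ + θ₂ * X r)) :
    Integrable (fun r => X r * p r) μ := by
  have hK : Kfun μ β X θ₁ θ₂ ≠ ⊤ := (show Kfun μ β X θ₁ θ₂ < ⊤ from hθ.1).ne
  rw [hst.Kfun_eq hs] at hK
  have hm : Measurable fun r => p r * (θ₁ + θ₂ * X r) - (β r (p r)).toReal :=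
    (hp.1.mul ((hst.Xmeas.const_mul θ₂).const_add θ₁)).sub
      (hst.measurable_comp hp.1 hp.2.1).ereal_toReal
  have hl : Integrable (fun r => (θ₁ * p₀ r + θ₂ * (X r * p₀ r)) - (β r (p₀ r)).toReal) μ :=
    ((hst.dens₀.integrable.const_mul θ₁).add (hst.integrable_payoff₀.const_mul θ₂)).sub
      hst.entropy₀.2.1
  have hi := integrable_of_le_of_eInt_lt_top hm.aestronglyMeasurable hl (by
    filter_upwards [hs, hst.entropy₀.1] with r hr ht
    have := hr.le_of_le (hst.fibre r) (hst.dens₀.2.1 r) ((hst.fibre r).coe_toReal ht).ge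
    linarith) hK
  refine (((hi.add hH).sub (hp.integrable.const_mul θ₁)).const_mul θ₂⁻¹).congr
    (Eventually.of_forall fun r => ?_)
  simp only [Pi.add_apply, Pi.sub_apply]
  field_simp [hθ₂.ne]
  ring

/-- The subgradient inequality, integrated: a lower bound for payoffs over entropy balls. -/
lemma Standing.le_xInt_of_isSubgradient (hst : Standing μ β β' X p₀ b₀) (hθ₂ : θ₂ < 0)
    {p : Ω → ℝ} (hp : IsDensity μ p) (hX : Integrable (fun r => X r * p r) μ)
    (hH : Integrable (fun r => (β r (p r)).toReal) μ)
    (hs : ∀ᵐ r ∂μ, IsSubgradient (β r) (p r) (θ₁ + θ₂ * X r)) {q : Ω → ℝ} (hq : IsDensity μ q)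
    (hqk : Hfun μ β q ≤ (k : EReal)) :
    ((∫ r, X r * p r ∂μ + (∫ r, (β r (p r)).toReal ∂μ - k) / (-θ₂) : ℝ) : EReal) ≤
      xInt μ X q := by
  obtain ⟨hqt, hqi, hqe⟩ :=
    hst.finite_entropy hq (ne_top_of_le_ne_top (EReal.coe_ne_top k) hqk)
  have hqk : ∫ r, (β r (q r)).toReal ∂μ ≤ k := by
    rw [hqe] at hqk
    exact_mod_cast hqk
  by_cases ht : xInt μ X q = ⊤
  · rw [ht]
    exact le_top
  have h1 : Integrable (fun r => (β r (p r)).toReal - (β r (q r)).toReal) μ := hH.sub hqi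
  have h2 : Integrable (fun r => q r - p r) μ := hq.integrable.sub hp.integrable
  have h12 : Integrable (fun r => (-θ₂)⁻¹ * ((β r (p r)).toReal - (β r (q r)).toReal) +
    (-θ₂)⁻¹ * θ₁ * (q r - p r)) μ := (h1.const_mul _).add (h2.const_mul _)
  have hl : Integrable (fun r => X r * p r +
      ((-θ₂)⁻¹ * ((β r (p r)).toReal - (β r (q r)).toReal) + (-θ₂)⁻¹ * θ₁ * (q r - p r))) μ :=
    hX.add h12
  have hle : ∀ᵐ r ∂μ, X r * p r + ((-θ₂)⁻¹ * ((β r (p r)).toReal - (β r (q r)).toReal) +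
      (-θ₂)⁻¹ * θ₁ * (q r - p r)) ≤ X r * q r := by
    filter_upwards [hs, hqt] with r hr ht
    have h := hr.le_of_le (hst.fibre r) (hq.2.1 r) ((hst.fibre r).coe_toReal ht).ge
    have hpos : 0 < -θ₂ := by linarith
    have h3 : (-θ₂)⁻¹ * ((β r (p r)).toReal - (β r (q r)).toReal) + (-θ₂)⁻¹ * θ₁ * (q r - p r) =
        (-θ₂)⁻¹ * ((β r (p r)).toReal - (β r (q r)).toReal + θ₁ * (q r - p r)) := by ring
    have h4 : (-θ₂)⁻¹ * ((β r (p r)).toReal - (β r (q r)).toReal + θ₁ * (q r - p r)) ≤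
        X r * q r - X r * p r := by
      rw [inv_mul_le_iff₀ hpos]
      linarith
    linarith
  have hXq : Integrable (fun r => X r * q r) μ :=
    integrable_of_le_of_eInt_lt_top (hst.Xmeas.mul hq.1).aestronglyMeasurable hl hle ht
  have hint := integral_mono_ae hl hXq hle
  rw [integral_add hX h12, integral_combo h1 h2, integral_sub hH hqi,
    integral_sub hq.integrable hp.integrable, hq.integral_eq_one, hp.integral_eq_one] at hint
  have hmono : (∫ r, (β r (p r)).toReal ∂μ - k) / (-θ₂) ≤
      (-θ₂)⁻¹ * (∫ r, (β r (p r)).toReal ∂μ - ∫ r, (β r (q r)).toReal ∂μ) := by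
    rw [div_eq_inv_mul]
    exact mul_le_mul_of_nonneg_left (by linarith) (inv_nonneg.2 (by linarith))
  rw [xInt_eq hXq]
  refine EReal.coe_le_coe_iff.2 ?_
  linarith

lemma Standing.xInt_eq_Vfun (hst : Standing μ β β' X p₀ b₀) (hψ : IsConjDeriv β β' ψ)
    (hθ : (θ₁, θ₂) ∈ ThetaSet μ β β' X) (hθ₂ : θ₂ < 0) {p : Ω → ℝ} (hp : IsDensity μ p)
    (he : p =ᵐ[μ] pFam ψ X θ₁ θ₂) (hHk : Hfun μ β p = (k : EReal)) :
    xInt μ X p = Vfun μ β X k := by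
  have hs := hst.isSubgradient_of_eq_pFam hψ hθ he
  obtain ⟨-, hH, hHe⟩ := hst.finite_entropy hp (by simp [hHk])
  have hX := hst.integrable_payoff_of_Kfun hθ hθ₂ hp hH hs
  rw [hHk] at hHe
  have hHe : k = ∫ r, (β r (p r)).toReal ∂μ := by exact_mod_cast hHe
  refine le_antisymm (le_iInf fun ⟨q, hq, hqk⟩ => ?_)
    (iInf_le (fun p : {p : Ω → ℝ // IsDensity μ p ∧ Hfun μ β p ≤ (k : EReal)} =>
      xInt μ X p.1) ⟨p, hp, hHk.le⟩)
  have := hst.le_xInt_of_isSubgradient hθ₂ hp hX hH hs hq hqk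
  rw [← hHe, sub_self, zero_div, add_zero] at this
  rwa [xInt_eq hX]

lemma Standing.Hfun_le_of_xInt_eq_Vfun (hst : Standing μ β β' X p₀ b₀) (hψ : IsConjDeriv β β' ψ)
    (hk0 : 0 < k) (hkmax : (k : EReal) < kmax μ β X b₀)
    (hθ : (θ₁, θ₂) ∈ ThetaSet μ β β' X) (hθ₂ : θ₂ < 0) {p : Ω → ℝ} (hp : IsDensity μ p)
    (he : p =ᵐ[μ] pFam ψ X θ₁ θ₂) (hV : xInt μ X p = Vfun μ β X k) :
    Hfun μ β p ≤ (k : EReal) := by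
  have hs := hst.isSubgradient_of_eq_pFam hψ hθ he
  have hX := (hst.integrable_of_optimal hk0 hkmax hp.1 hV).1
  have hu : Integrable (fun r => (β r (p₀ r)).toReal + (θ₁ * p r + θ₂ * (X r * p r)) -
      (θ₁ * p₀ r + θ₂ * (X r * p₀ r))) μ :=
    (hst.entropy₀.2.1.add ((hp.integrable.const_mul θ₁).add (hX.const_mul θ₂))).sub
      ((hst.dens₀.integrable.const_mul θ₁).add (hst.integrable_payoff₀.const_mul θ₂))
  have hHt : Hfun μ β p ≠ ⊤ := by
    refine ne_top_of_le_ne_top (EReal.coe_ne_top _) (Hfun_le_of_le hu ?_)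
    filter_upwards [hs, hst.entropy₀.1] with r hr ht
    have := hr.le_of_le (hst.fibre r) (hst.dens₀.2.1 r) ((hst.fibre r).coe_toReal ht).ge
    refine ((hst.fibre r).coe_toReal hr.2.1).ge.trans (EReal.coe_le_coe_iff.2 ?_)
    linarith
  obtain ⟨-, hH, hHe⟩ := hst.finite_entropy hp hHt
  by_contra! hcon
  rw [hHe] at hcon
  have hcon : k < ∫ r, (β r (p r)).toReal ∂μ := by exact_mod_cast hcon
  have hle : ((∫ r, X r * p r ∂μ + (∫ r, (β r (p r)).toReal ∂μ - k) / (-θ₂) : ℝ) : EReal) ≤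
      Vfun μ β X k := le_iInf fun ⟨q, hq, hqk⟩ =>
    hst.le_xInt_of_isSubgradient hθ₂ hp hX hH hs hq hqk
  rw [← hV, xInt_eq hX] at hle
  have hle := EReal.coe_le_coe_iff.1 hle
  have : 0 < (∫ r, (β r (p r)).toReal ∂μ - k) / (-θ₂) := div_pos (by linarith) (by linarith)
  linarith

end Optimality

/-- Lemma on optimality, part (ii). For `k ∈ (0, k_max)`, a density
`p` attains the infimum defining `V(k)` iff `p = p_{θ₁,θ₂}` μ-a.e. for some
`(θ₁,θ₂) ∈ Θ` with `θ₂ < 0` and `H(p_{θ₁,θ₂}) = k`; moreover for such `p_{θ₁,θ₂}` the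
condition `H(p_{θ₁,θ₂}) = k` is equivalent to `∫ X p_{θ₁,θ₂} dμ = V(k)`. -/
theorem optimality_part_ii {Ω : Type*} [MeasurableSpace Ω] (μ : Measure Ω)
    (β : Ω → ℝ → EReal) (β' : Ω → ℝ → ℝ) (ψ : Ω → ℝ → ℝ) (X : Ω → ℝ) (p₀ : Ω → ℝ) (b₀ : ℝ)
    (hst : Standing μ β β' X p₀ b₀) (hψ : IsConjDeriv β β' ψ)
    (k : ℝ) (hk0 : 0 < k) (hkmax : (k : EReal) < kmax μ β X b₀) :
    (∀ p : Ω → ℝ, IsDensity μ p →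
      ((Hfun μ β p ≤ (k : EReal) ∧ xInt μ X p = Vfun μ β X k) ↔
        (∃ θ₁ θ₂ : ℝ, (θ₁, θ₂) ∈ ThetaSet μ β β' X ∧ θ₂ < 0 ∧
          p =ᵐ[μ] pFam ψ X θ₁ θ₂ ∧
          Hfun μ β (pFam ψ X θ₁ θ₂) = (k : EReal)))) ∧
    (∀ θ₁ θ₂ : ℝ, (θ₁, θ₂) ∈ ThetaSet μ β β' X → θ₂ < 0 →
      IsDensity μ (pFam ψ X θ₁ θ₂) →
      (Hfun μ β (pFam ψ X θ₁ θ₂) = (k : EReal) ↔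
        xInt μ X (pFam ψ X θ₁ θ₂) = Vfun μ β X k)) := by
  have hcongr : ∀ {p q : Ω → ℝ}, p =ᵐ[μ] q → Hfun μ β p = Hfun μ β q := fun h =>
    eInt_congr (by filter_upwards [h] with r hr; rw [hr])
  refine ⟨fun p hp => ⟨fun ⟨hH, hV⟩ => ?_, fun ⟨θ₁, θ₂, hθ, hθ₂, he, hHk⟩ => ?_⟩,
    fun θ₁ θ₂ hθ hθ₂ hp => ⟨fun hHk => hst.xInt_eq_Vfun hψ hθ hθ₂ hp EventuallyEq.rfl hHk,
      fun hV => ?_⟩⟩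
  · obtain ⟨θ₁, θ₂, hθ₂, hs, hHk⟩ := hst.exists_subgradient_of_optimal hk0 hkmax hp hH hV
    have hHt : Hfun μ β p ≠ ⊤ := by simp [hHk]
    have he := hst.eq_pFam_of_isSubgradient hψ hs
    have hX := (hst.integrable_of_optimal hk0 hkmax hp.1 hV).1
    exact ⟨θ₁, θ₂, hst.mem_ThetaSet (hst.admissible hp hHt hX) (hst.finite_entropy hp hHt).2.1 hs,
      hθ₂, he, by rw [← hcongr he, hHk]⟩
  · rw [← hcongr he] at hHk
    exact ⟨hHk.le, hst.xInt_eq_Vfun hψ hθ hθ₂ hp he hHk⟩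
  · have hH := hst.Hfun_le_of_xInt_eq_Vfun hψ hk0 hkmax hθ hθ₂ hp EventuallyEq.rfl hV
    obtain ⟨-, -, -, -, hHk⟩ := hst.exists_subgradient_of_optimal hk0 hkmax hp hH hV
    exact hHk
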